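/- (gl_n Heine transformation, Corollary 8.2 of the paper) Fix b ∈ ℂ, a composition v ∈ ℕ^n and x ∈ ℂ^n. There exists ε > 0 such that for all a, c ∈ ℂ with 0 < |a| < ε and 0 < |c| < ε and (ab/c)_v ≠ 0: all quantities (c t^{n−1})_u and (a t^{n−1})_u are nonzero, both families below (indexed by all compositions u ∈ ℕ^n) are absolutely summable, and Σ_u a^{|u|} ((b)_u/(c t^{n−1})_u) [u; v] 𝖬_u(x) = (a/c)^{|v|} ((b)_v/(ab/c)_v) · (∏_{i=1}^n (a t^{n−i}; q)_∞ (c x_i; q)_∞ / ((c t^{n−i}; q)_∞ (a x_i; q)_∞)) · Σ_u c^{|u|} ((ab/c)_u/(a t^{n−1})_u) [u; v] 𝖬_u(x). -/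

import Mathlib

open scoped BigOperators
open MvPolynomial

noncomputable section
namespace LRW

variable {n : ℕ}

/-- `|u|`, the weight of a composition `u ∈ ℕⁿ`. -/
def wt (u : Fin n → ℕ) : ℕ := ∑ i, u i

/-- `l'_u(i) = #{k > i : u_k > u_i} + #{k < i : u_k ≥ u_i}`. -/
def lp (u : Fin n → ℕ) (i : Fin n) : ℕ :=
  (Finset.univ.filter fun k => i < k ∧ u i < u k).card +
  (Finset.univ.filter fun k => k < i ∧ u i ≤ u k).card

/-- The spectral vector `⟨u⟩ : ⟨u⟩_i = q^{u_i} t^{n−1−l'_u(i)}`. -/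
def spec (q t : ℂ) (u : Fin n → ℕ) : Fin n → ℂ :=
  fun i => q ^ u i * t ^ (n - 1 - lp u i)

/-- Leg length `l(s)` of the cell `s = (i, j+1)` of `u` (so `j` ranges over
`0, …, u_i − 1`): `l(s) = #{k > i : j+1 ≤ u_k ≤ u_i} + #{k < i : j+1 ≤ u_k + 1 ≤ u_i}`. -/
def leg (u : Fin n → ℕ) (i : Fin n) (j : ℕ) : ℕ :=
  (Finset.univ.filter fun k => i < k ∧ j < u k ∧ u k ≤ u i).card +
  (Finset.univ.filter fun k => k < i ∧ j ≤ u k ∧ u k < u i).card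

/-- `n(u) = Σ_{s ∈ u} l(s)`. -/
def nstat (u : Fin n → ℕ) : ℕ := ∑ i, ∑ j ∈ Finset.range (u i), leg u i j

/-- `n'(u) = Σ_i C(u_i, 2)`. -/
def nstat' (u : Fin n → ℕ) : ℕ := ∑ i, Nat.choose (u i) 2

/-- `n(u⁺) = Σ_{i<j} min(u_i, u_j)`, the statistic `n` of the decreasing
rearrangement of `u`. -/
def nplus (u : Fin n → ℕ) : ℕ := ∑ i, ∑ j, if i < j then min (u i) (u j) else 0

/-- `τ_u = (−1)^{|u|} q^{n'(u)} t^{−n(u⁺)}`. -/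
def tau (q t : ℂ) (u : Fin n → ℕ) : ℂ := (-1) ^ wt u * q ^ nstat' u / t ^ nplus u

/-- The generalized q-shifted factorial `(z)_u = ∏_{s ∈ u} (1 − z q^{a'(s)} t^{−l'(s)})`. -/
def qfac (q t z : ℂ) (u : Fin n → ℕ) : ℂ :=
  ∏ i, ∏ j ∈ Finset.range (u i), (1 - z * q ^ j / t ^ lp u i)

/-- `c'_u = ∏_{s ∈ u} (1 − q^{a(s)+1} t^{l(s)})`. -/
def cp (q t : ℂ) (u : Fin n → ℕ) : ℂ :=
  ∏ i, ∏ j ∈ Finset.range (u i), (1 - q ^ (u i - j) * t ^ leg u i j)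

/-- `M` is a family of interpolation Macdonald polynomials: `M u` has total degree
at most `|u|`, the coefficient of `x^u` in `M u` is `q^{−n'(u)}`, and `M u`
vanishes at `⟨v⟩` for every `v` with `|v| ≤ |u|`, `v ≠ u`. -/
def IsInterpFamily (q t : ℂ) (M : (Fin n → ℕ) → MvPolynomial (Fin n) ℂ) : Prop :=
  ∀ u, (M u).totalDegree ≤ wt u ∧
    coeff (Finsupp.equivFunOnFinite.symm u) (M u) = (q ^ nstat' u)⁻¹ ∧
    ∀ v, wt v ≤ wt u → v ≠ u → eval (spec q t v) (M u) = 0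

/-- `𝖬_u = q^{n'(u)} t^{n(u)} M_u / c'_u`. -/
def MM (q t : ℂ) (M : (Fin n → ℕ) → MvPolynomial (Fin n) ℂ) (u : Fin n → ℕ) :
    MvPolynomial (Fin n) ℂ :=
  C (q ^ nstat' u * t ^ nstat u / cp q t u) * M u

/-- `𝖤_u = t^{n(u)} E_u / c'_u`, where `E_u` is the homogeneous component of
degree `|u|` of `M_u`. -/
def EE (q t : ℂ) (M : (Fin n → ℕ) → MvPolynomial (Fin n) ℂ) (u : Fin n → ℕ) :
    MvPolynomial (Fin n) ℂ :=
  C (t ^ nstat u / cp q t u) * homogeneousComponent (wt u) (M u)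

/-- The generalized q-binomial coefficient `[u; v] = 𝖬_v(⟨u⟩)/𝖬_v(⟨v⟩)`. -/
def qbin (q t : ℂ) (M : (Fin n → ℕ) → MvPolynomial (Fin n) ℂ) (u v : Fin n → ℕ) : ℂ :=
  eval (spec q t u) (MM q t M v) / eval (spec q t v) (MM q t M v)

/-- `⟨0⟩/a = (t^{n−1}/a, …, t/a, 1/a)`. -/
def spec0div (q t a : ℂ) : Fin n → ℂ := fun i => spec q t (fun _ => 0) i / a

/-- `cc` is the family of connection coefficients `c_{uv}(a,b)`:
`cc u v = 0` unless `|v| ≤ |u|`, and `𝖬_u(a·x) = Σ_v cc u v · 𝖬_v(b·x)`. -/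
def IsConnection (q t : ℂ) (M : (Fin n → ℕ) → MvPolynomial (Fin n) ℂ) (a b : ℂ)
    (cc : (Fin n → ℕ) → (Fin n → ℕ) → ℂ) : Prop :=
  (∀ u v, wt u < wt v → cc u v = 0) ∧
  ∀ u, aeval (fun i => C a * X i) (MM q t M u) =
    ∑ᶠ v, cc u v • aeval (fun i => C b * X i) (MM q t M v)

/-- `⟦u, v⟧(a, b) = (𝖤_v(⟨0⟩/a)/𝖤_u(⟨0⟩/b)) · c_{uv}(a, b)`. -/
def skew (q t : ℂ) (M : (Fin n → ℕ) → MvPolynomial (Fin n) ℂ) (a b : ℂ)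
    (cc : (Fin n → ℕ) → (Fin n → ℕ) → ℂ) (u v : Fin n → ℕ) : ℂ :=
  eval (spec0div q t a) (EE q t M v) / eval (spec0div q t b) (EE q t M u) * cc u v

/-- `(z; q)_∞ = ∏_{m ≥ 0} (1 − z q^m)`. -/
noncomputable def qpochInf (z q : ℂ) : ℂ := ∏' m : ℕ, (1 - z * q ^ m)

/-- The standing hypotheses on the parameters `q` and `t`. -/
structure Generic (q t : ℂ) : Prop where
  q_ne : q ≠ 0
  q_lt : ‖q‖ < 1
  t_ne : t ≠ 0
  indep : ∀ i j : ℤ, ¬(i = 0 ∧ j = 0) → q ^ i * t ^ j ≠ 1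

theorem Generic.pow_inj {q t : ℂ} (h : Generic q t) {a b c d : ℕ}
    (e : q ^ a * t ^ b = q ^ c * t ^ d) : a = c ∧ b = d := by
  by_contra hne
  have hq := h.q_ne
  have ht := h.t_ne
  refine h.indep ((a : ℤ) - c) ((b : ℤ) - d) (by omega) ?_
  rw [zpow_sub₀ hq, zpow_sub₀ ht]
  simp only [zpow_natCast]
  field_simp
  exact e

/-- Move the first entry to the last position and increase it by one. -/
def phi {m : ℕ} (u : Fin (m + 1) → ℕ) : Fin (m + 1) → ℕ :=
  Fin.snoc (α := fun _ => ℕ) (fun i => u i.succ) (u 0 + 1)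

/-- Append a zero entry. -/
def app {m : ℕ} (u : Fin m → ℕ) : Fin (m + 1) → ℕ :=
  Fin.snoc (α := fun _ => ℕ) u 0

/-- The adjacent transposition of the positions `k` and `k + 1`. -/
def adj {m : ℕ} (k : Fin m) : Equiv.Perm (Fin (m + 1)) := Equiv.swap k.castSucc k.succ

@[simp] theorem phi_last {m : ℕ} (u : Fin (m + 1) → ℕ) : phi u (Fin.last m) = u 0 + 1 := by
  simp [phi]

@[simp] theorem phi_castSucc {m : ℕ} (u : Fin (m + 1) → ℕ) (i : Fin m) :
    phi u i.castSucc = u i.succ := by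
  simp [phi]

@[simp] theorem app_last {m : ℕ} (u : Fin m → ℕ) : app u (Fin.last m) = 0 := by
  simp [app]

@[simp] theorem app_castSucc {m : ℕ} (u : Fin m → ℕ) (i : Fin m) :
    app u i.castSucc = u i := by
  simp [app]

@[simp] theorem adj_castSucc {m : ℕ} (k : Fin m) : adj k k.castSucc = k.succ := by simp [adj]

@[simp] theorem adj_succ {m : ℕ} (k : Fin m) : adj k k.succ = k.castSucc := by simp [adj]

@[simp] theorem adj_adj {m : ℕ} (k : Fin m) (i : Fin (m + 1)) : adj k (adj k i) = i := by
  simp [adj]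

theorem exists_phi_or_app {m : ℕ} (u : Fin (m + 1) → ℕ) :
    (∃ w, u = phi w) ∨ (∃ w : Fin m → ℕ, u = app w) := by
  rcases h : u (Fin.last m) with _ | d
  · right
    refine ⟨fun i => u i.castSucc, ?_⟩
    ext i
    refine Fin.lastCases ?_ (fun i => ?_) i <;> simp [h]
  · left
    refine ⟨Fin.cons (α := fun _ => ℕ) d (fun i => u i.castSucc), ?_⟩
    ext i
    refine Fin.lastCases ?_ (fun i => ?_) i <;> simp [h]

theorem phi_injective {m : ℕ} : Function.Injective (phi (m := m)) := by
  intro u w h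
  ext i
  refine Fin.cases ?_ (fun i => ?_) i
  · simpa using congrFun h (Fin.last m)
  · simpa using congrFun h i.castSucc

theorem app_injective {m : ℕ} : Function.Injective (app (m := m)) := by
  intro u w h
  ext i
  simpa using congrFun h i.castSucc

theorem wt_phi {m : ℕ} (u : Fin (m + 1) → ℕ) : wt (phi u) = wt u + 1 := by
  rw [wt, wt, Fin.sum_univ_castSucc, Fin.sum_univ_succ]
  simp
  ring

theorem wt_app {m : ℕ} (u : Fin m → ℕ) : wt (app u) = wt u := by
  rw [wt, wt, Fin.sum_univ_castSucc]
  simp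

theorem wt_comp (u : Fin n → ℕ) (σ : Equiv.Perm (Fin n)) : wt (u ∘ σ) = wt u :=
  Equiv.sum_comp σ u

theorem lp_eq_card (u : Fin n → ℕ) (i : Fin n) :
    lp u i = (Finset.univ.filter fun k => u i < u k ∨ (u k = u i ∧ k < i)).card := by
  rw [lp, ← Finset.card_union_of_disjoint]
  · congr 1
    ext k
    simp only [Finset.mem_union, Finset.mem_filter, Finset.mem_univ, true_and]
    constructor
    · rintro (⟨h1, h2⟩ | ⟨h1, h2⟩)
      · exact Or.inl h2
      · rcases h2.lt_or_eq with h | h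
        · exact Or.inl h
        · exact Or.inr ⟨h.symm, h1⟩
    · rintro (h | ⟨h1, h2⟩)
      · rcases lt_trichotomy i k with hk | hk | hk
        · exact Or.inl ⟨hk, h⟩
        · subst hk; exact absurd h (lt_irrefl _)
        · exact Or.inr ⟨hk, h.le⟩
      · exact Or.inr ⟨h2, h1.ge⟩
  · rw [Finset.disjoint_filter]
    rintro k - ⟨h1, -⟩ ⟨h2, -⟩
    exact absurd h1 h2.asymm

theorem lp_eq_sum (u : Fin n → ℕ) (i : Fin n) :
    lp u i = ∑ k, if u i < u k ∨ (u k = u i ∧ k < i) then 1 else 0 := by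
  rw [lp_eq_card, Finset.card_filter]

theorem lp_lt (u : Fin n → ℕ) (i : Fin n) : lp u i < n := by
  rw [lp_eq_card]
  have : (Finset.univ.filter fun k => u i < u k ∨ (u k = u i ∧ k < i)) ⊂ Finset.univ := by
    rw [Finset.filter_ssubset]
    exact ⟨i, Finset.mem_univ _, by simp⟩
  simpa using Finset.card_lt_card this

theorem lp_lt_lp {u : Fin n → ℕ} {i k : Fin n} (h : u i < u k ∨ (u k = u i ∧ k < i)) :
    lp u k < lp u i := by
  rw [lp_eq_card, lp_eq_card]
  apply Finset.card_lt_card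
  rw [Finset.ssubset_iff_of_subset]
  · exact ⟨k, by simp [h], by simp⟩
  · intro j
    simp only [Finset.mem_filter, Finset.mem_univ, true_and]
    omega

theorem lp_injective (u : Fin n → ℕ) : Function.Injective (lp u) := by
  intro i k h
  by_contra hne
  rcases lt_trichotomy (u i) (u k) with h1 | h1 | h1
  · exact (lp_lt_lp (Or.inl h1)).ne' h
  · rcases lt_or_gt_of_ne hne with h2 | h2
    · exact (lp_lt_lp (Or.inr ⟨h1, h2⟩)).ne h
    · exact (lp_lt_lp (Or.inr ⟨h1.symm, h2⟩)).ne' h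
  · exact (lp_lt_lp (Or.inl h1)).ne h

theorem lp_phi_last {m : ℕ} (u : Fin (m + 1) → ℕ) : lp (phi u) (Fin.last m) = lp u 0 := by
  rw [lp_eq_sum, lp_eq_sum, Fin.sum_univ_castSucc, Fin.sum_univ_succ (n := m)]
  simp only [phi_last, phi_castSucc, lt_irrefl, Fin.castSucc_lt_last, and_true, and_false,
    or_false, if_false, add_zero, zero_add, Fin.not_lt_zero]
  refine Finset.sum_congr rfl fun i _ => ?_
  congr 1
  apply propext
  omega

theorem lp_phi_castSucc {m : ℕ} (u : Fin (m + 1) → ℕ) (i : Fin m) :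
    lp (phi u) i.castSucc = lp u i.succ := by
  rw [lp_eq_sum, lp_eq_sum, Fin.sum_univ_castSucc, Fin.sum_univ_succ (n := m), add_comm]
  congr 1
  · simp only [phi_last, phi_castSucc, Fin.succ_pos, and_true]
    congr 1
    have := (Fin.castSucc_lt_last i).not_gt
    apply propext
    simp only [this, and_false, or_false]
    omega
  · simp

theorem lp_app_last {m : ℕ} (u : Fin m → ℕ) : lp (app u) (Fin.last m) = m := by
  rw [lp_eq_sum, Fin.sum_univ_castSucc]
  simp only [app_last, app_castSucc, Fin.castSucc_lt_last, and_true, lt_irrefl, and_false,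
    or_false, if_false, add_zero]
  rw [Finset.sum_congr rfl (g := fun _ => 1)]
  · simp
  · intro i _
    rw [if_pos]
    omega

theorem lp_app_castSucc {m : ℕ} (u : Fin m → ℕ) (i : Fin m) :
    lp (app u) i.castSucc = lp u i := by
  rw [lp_eq_sum, lp_eq_sum, Fin.sum_univ_castSucc]
  have := (Fin.castSucc_lt_last i).not_gt
  simp [this]

theorem lp_comp_adj {m : ℕ} (u : Fin (m + 1) → ℕ) (k : Fin m)
    (h : u k.castSucc ≠ u k.succ) (i : Fin (m + 1)) : lp (u ∘ adj k) (adj k i) = lp u i := by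
  rw [lp_eq_sum, lp_eq_sum, ← Equiv.sum_comp (adj k)]
  refine Finset.sum_congr rfl fun j _ => ?_
  simp only [Function.comp, adj_adj]
  congr 1
  apply propext
  refine or_congr Iff.rfl (and_congr_right fun hji => ?_)
  have h1 : ¬(i = k.castSucc ∧ j = k.succ) := by
    rintro ⟨rfl, rfl⟩; exact h hji.symm
  have h2 : ¬(j = k.castSucc ∧ i = k.succ) := by
    rintro ⟨rfl, rfl⟩; exact h hji
  simp only [adj, Equiv.swap_apply_def]
  simp only [Fin.ext_iff, Fin.val_castSucc, Fin.val_succ] at h1 h2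
  split_ifs <;> simp only [Fin.lt_def, Fin.ext_iff, Fin.val_castSucc, Fin.val_succ] at * <;> omega

theorem lp_succ_of_eq {m : ℕ} (u : Fin (m + 1) → ℕ) (k : Fin m)
    (h : u k.castSucc = u k.succ) : lp u k.succ = lp u k.castSucc + 1 := by
  rw [lp_eq_card, lp_eq_card, ← Finset.card_insert_of_notMem (a := k.castSucc)]
  · congr 1
    ext j
    simp only [Finset.mem_insert, Finset.mem_filter, Finset.mem_univ, true_and, Fin.lt_def,
      Fin.ext_iff, Fin.val_castSucc, Fin.val_succ, h]
    constructor
    · rintro (h1 | ⟨h1, h2⟩) <;> omega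
    · rintro (h1 | h1 | ⟨h1, h2⟩)
      · right
        refine ⟨?_, by omega⟩
        rw [← h]; congr 1; ext; simpa using h1
      · exact Or.inl h1
      · exact Or.inr ⟨h1, by omega⟩
  · simp

/-- Cyclic rotation of a vector, multiplying the moved entry by `q`. -/
def rot {m : ℕ} (q : ℂ) (x : Fin (m + 1) → ℂ) : Fin (m + 1) → ℂ :=
  Fin.snoc (α := fun _ => ℂ) (fun i => x i.succ) (q * x 0)

/-- The inverse of `rot`. -/
def unrot {m : ℕ} (q : ℂ) (x : Fin (m + 1) → ℂ) : Fin (m + 1) → ℂ :=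
  Fin.cons (α := fun _ => ℂ) (x (Fin.last m) / q) (fun i => x i.castSucc)

/-- Scale a vector by `t` and append the entry `1`. -/
def extend {m : ℕ} (t : ℂ) (x : Fin m → ℂ) : Fin (m + 1) → ℂ :=
  Fin.snoc (α := fun _ => ℂ) (fun i => t * x i) 1

@[simp] theorem rot_last {m : ℕ} (q : ℂ) (x : Fin (m + 1) → ℂ) :
    rot q x (Fin.last m) = q * x 0 := by simp [rot]

@[simp] theorem rot_castSucc {m : ℕ} (q : ℂ) (x : Fin (m + 1) → ℂ) (i : Fin m) :
    rot q x i.castSucc = x i.succ := by simp [rot]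

@[simp] theorem unrot_zero {m : ℕ} (q : ℂ) (x : Fin (m + 1) → ℂ) :
    unrot q x 0 = x (Fin.last m) / q := by simp [unrot]

@[simp] theorem unrot_succ {m : ℕ} (q : ℂ) (x : Fin (m + 1) → ℂ) (i : Fin m) :
    unrot q x i.succ = x i.castSucc := by simp [unrot]

@[simp] theorem extend_last {m : ℕ} (t : ℂ) (x : Fin m → ℂ) :
    extend t x (Fin.last m) = 1 := by simp [extend]

@[simp] theorem extend_castSucc {m : ℕ} (t : ℂ) (x : Fin m → ℂ) (i : Fin m) :
    extend t x i.castSucc = t * x i := by simp [extend]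

theorem unrot_rot {m : ℕ} {q : ℂ} (hq : q ≠ 0) (x : Fin (m + 1) → ℂ) :
    unrot q (rot q x) = x := by
  ext i
  refine Fin.cases ?_ (fun i => ?_) i <;> simp [hq]

theorem rot_unrot {m : ℕ} {q : ℂ} (hq : q ≠ 0) (x : Fin (m + 1) → ℂ) :
    rot q (unrot q x) = x := by
  ext i
  refine Fin.lastCases ?_ (fun i => ?_) i
  · simp; field_simp
  · simp

theorem spec_phi {m : ℕ} (q t : ℂ) (u : Fin (m + 1) → ℕ) :
    spec q t (phi u) = rot q (spec q t u) := by
  ext i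
  refine Fin.lastCases ?_ (fun i => ?_) i
  · simp [spec, lp_phi_last]; ring
  · simp [spec, lp_phi_castSucc]

theorem spec_app {m : ℕ} (q t : ℂ) (u : Fin m → ℕ) :
    spec q t (app u) = extend t (spec q t u) := by
  ext i
  refine Fin.lastCases ?_ (fun i => ?_) i
  · simp [spec, lp_app_last]
  · have h := lp_lt u i
    simp only [spec, lp_app_castSucc, app_castSucc, extend_castSucc]
    rw [show m + 1 - 1 - lp u i = (m - 1 - lp u i) + 1 by omega]
    ring

theorem spec_comp_adj {m : ℕ} (q t : ℂ) (u : Fin (m + 1) → ℕ) (k : Fin m)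
    (h : u k.castSucc ≠ u k.succ) : spec q t (u ∘ adj k) = spec q t u ∘ adj k := by
  ext i
  have := lp_comp_adj u k h (adj k i)
  rw [adj_adj] at this
  simp [spec, this]

theorem spec_castSucc_of_eq {m : ℕ} (q t : ℂ) (u : Fin (m + 1) → ℕ) (k : Fin m)
    (h : u k.castSucc = u k.succ) :
    spec q t u k.castSucc = t * spec q t u k.succ := by
  have h1 := lp_succ_of_eq u k h
  have h2 := lp_lt u k.succ
  simp only [spec, h]
  rw [show m + 1 - 1 - lp u k.castSucc = (m + 1 - 1 - lp u k.succ) + 1 by omega]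
  ring

theorem spec_ne_zero {q t : ℂ} (hg : Generic q t) (u : Fin n → ℕ) (i : Fin n) :
    spec q t u i ≠ 0 :=
  mul_ne_zero (pow_ne_zero _ hg.q_ne) (pow_ne_zero _ hg.t_ne)

theorem spec_apply_injective {q t : ℂ} (hg : Generic q t) (u : Fin n → ℕ) :
    Function.Injective (spec q t u) := by
  intro i k h
  have h1 := (hg.pow_inj h).2
  have h2 := lp_lt u i
  have h3 := lp_lt u k
  exact lp_injective u (by omega)

theorem spec_phi_last_ne_one {m : ℕ} {q t : ℂ} (hg : Generic q t) (u : Fin (m + 1) → ℕ) :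
    spec q t (phi u) (Fin.last m) ≠ 1 := by
  intro h
  have := (hg.pow_inj (c := 0) (d := 0) (by simpa [spec] using h)).1
  simp at this

theorem spec_app_last {m : ℕ} (q t : ℂ) (u : Fin m → ℕ) :
    spec q t (app u) (Fin.last m) = 1 := by
  rw [spec_app, extend_last]

theorem app_ne_phi {m : ℕ} (u : Fin m → ℕ) (w : Fin (m + 1) → ℕ) : app u ≠ phi w := by
  intro h
  have := congrFun h (Fin.last m)
  simp at this

theorem eval_aeval_apply {k : ℕ} (f : Fin k → MvPolynomial (Fin n) ℂ) (x : Fin n → ℂ)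
    (p : MvPolynomial (Fin k) ℂ) : eval x (aeval f p) = eval (fun i => eval x (f i)) p := by
  induction p using MvPolynomial.induction_on with
  | C a => simp
  | add p r hp hr => simp only [map_add, hp, hr]
  | mul_X p i hp => simp only [map_mul, hp, aeval_X, eval_X]

theorem totalDegree_aeval_le_of_le_one {k : ℕ} (f : Fin k → MvPolynomial (Fin n) ℂ)
    (hf : ∀ i, (f i).totalDegree ≤ 1) (p : MvPolynomial (Fin k) ℂ) :
    (aeval f p).totalDegree ≤ p.totalDegree := by
  rw [aeval_def, eval₂_eq']
  refine totalDegree_finsetSum_le fun d hd => ?_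
  refine (totalDegree_mul _ _).trans ?_
  rw [algebraMap_eq, totalDegree_C, zero_add]
  refine (totalDegree_finsetProd _ _).trans ?_
  refine le_trans (Finset.sum_le_sum (g := fun i => d i) fun i _ => ?_) ?_
  · refine (totalDegree_pow _ _).trans ?_
    simpa using Nat.mul_le_mul_left (d i) (hf i)
  · refine le_trans (le_of_eq ?_) (le_totalDegree hd)
    rw [Finsupp.sum_fintype]
    simp

theorem totalDegree_C_mul_X_le (a : ℂ) (i : Fin n) :
    (C a * X i : MvPolynomial (Fin n) ℂ).totalDegree ≤ 1 := by
  refine (totalDegree_mul _ _).trans ?_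
  simp

/-- If an algebra endomorphism is the identity modulo `g` on the variables, it is the identity
modulo `g`. -/
theorem dvd_sub_of_dvd_X_sub (θ : MvPolynomial (Fin n) ℂ →ₐ[ℂ] MvPolynomial (Fin n) ℂ)
    (g : MvPolynomial (Fin n) ℂ) (h : ∀ k, g ∣ X k - θ (X k)) (p : MvPolynomial (Fin n) ℂ) :
    g ∣ p - θ p := by
  have : (Ideal.Quotient.mkₐ ℂ (Ideal.span {g})) =
      (Ideal.Quotient.mkₐ ℂ (Ideal.span {g})).comp θ := by
    refine algHom_ext fun k => ?_
    simp only [AlgHom.comp_apply, Ideal.Quotient.mkₐ_eq_mk]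
    rw [Ideal.Quotient.eq, Ideal.mem_span_singleton]
    exact h k
  have h2 := DFunLike.congr_fun this p
  simp only [AlgHom.comp_apply, Ideal.Quotient.mkₐ_eq_mk] at h2
  rwa [Ideal.Quotient.eq, Ideal.mem_span_singleton] at h2

/-- A polynomial that vanishes when the variable `k` is set to `a` is divisible by `X k - a`. -/
theorem X_sub_C_dvd {k : Fin n} {a : ℂ} {p : MvPolynomial (Fin n) ℂ}
    (h : ∀ x : Fin n → ℂ, x k = a → eval x p = 0) : (X k - C a) ∣ p := by
  set θ : MvPolynomial (Fin n) ℂ →ₐ[ℂ] MvPolynomial (Fin n) ℂ :=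
    aeval (fun i => if i = k then C a else X i) with hθ
  have h1 : θ p = 0 := by
    refine MvPolynomial.funext fun x => ?_
    rw [hθ, eval_aeval_apply, h _ (by simp), map_zero]
  have := dvd_sub_of_dvd_X_sub θ (X k - C a) (fun i => ?_) p
  · rwa [h1, sub_zero] at this
  · rw [hθ, aeval_X]
    split_ifs with hi
    · rw [hi]
    · simp

theorem totalDegree_X_sub_C (k : Fin n) (a : ℂ) :
    (X k - C a : MvPolynomial (Fin n) ℂ).totalDegree = 1 := by
  rw [sub_eq_add_neg, ← C_neg, totalDegree_add_eq_left_of_totalDegree_lt] <;> simp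

theorem X_sub_C_ne_zero (k : Fin n) (a : ℂ) : (X k - C a : MvPolynomial (Fin n) ℂ) ≠ 0 := by
  intro h
  have := totalDegree_X_sub_C k a
  rw [h] at this
  simp at this

theorem totalDegree_X_sub_C_mul {k : Fin n} {a : ℂ} {g : MvPolynomial (Fin n) ℂ} (hg : g ≠ 0) :
    ((X k - C a) * g).totalDegree = g.totalDegree + 1 := by
  rw [totalDegree_mul_of_isDomain (X_sub_C_ne_zero k a) hg, totalDegree_X_sub_C, add_comm]

/-- Substitution operator dual to `rot`. -/
def protate {m : ℕ} (q : ℂ) : MvPolynomial (Fin (m + 1)) ℂ →ₐ[ℂ] MvPolynomial (Fin (m + 1)) ℂ :=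
  aeval (Fin.snoc (α := fun _ => MvPolynomial (Fin (m + 1)) ℂ) (fun i => X i.succ) (C q * X 0))

/-- Substitution operator dual to `unrot`. -/
def punrotate {m : ℕ} (q : ℂ) : MvPolynomial (Fin (m + 1)) ℂ →ₐ[ℂ] MvPolynomial (Fin (m + 1)) ℂ :=
  aeval (Fin.cons (α := fun _ => MvPolynomial (Fin (m + 1)) ℂ) (C q⁻¹ * X (Fin.last m))
    (fun i => X i.castSucc))

/-- Substitution operator dual to `extend`. -/
def pextend {m : ℕ} (t : ℂ) : MvPolynomial (Fin (m + 1)) ℂ →ₐ[ℂ] MvPolynomial (Fin m) ℂ :=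
  aeval (Fin.snoc (α := fun _ => MvPolynomial (Fin m) ℂ) (fun i => C t * X i) 1)

@[simp] theorem eval_protate {m : ℕ} (q : ℂ) (x : Fin (m + 1) → ℂ)
    (p : MvPolynomial (Fin (m + 1)) ℂ) : eval x (protate q p) = eval (rot q x) p := by
  rw [protate, eval_aeval_apply]
  congr 2
  ext i
  refine Fin.lastCases ?_ (fun i => ?_) i <;> simp

@[simp] theorem eval_punrotate {m : ℕ} (q : ℂ) (x : Fin (m + 1) → ℂ)
    (p : MvPolynomial (Fin (m + 1)) ℂ) : eval x (punrotate q p) = eval (unrot q x) p := by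
  rw [punrotate, eval_aeval_apply]
  congr 2
  ext i
  refine Fin.cases ?_ (fun i => ?_) i
  · simp [div_eq_inv_mul]
  · simp

@[simp] theorem eval_pextend {m : ℕ} (t : ℂ) (x : Fin m → ℂ)
    (p : MvPolynomial (Fin (m + 1)) ℂ) : eval x (pextend t p) = eval (extend t x) p := by
  rw [pextend, eval_aeval_apply]
  congr 2
  ext i
  refine Fin.lastCases ?_ (fun i => ?_) i <;> simp

theorem totalDegree_protate_le {m : ℕ} (q : ℂ) (p : MvPolynomial (Fin (m + 1)) ℂ) :
    (protate q p).totalDegree ≤ p.totalDegree := by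
  refine totalDegree_aeval_le_of_le_one _ (fun i => ?_) p
  refine Fin.lastCases ?_ (fun i => ?_) i
  · simpa using totalDegree_C_mul_X_le q 0
  · simp

theorem totalDegree_punrotate_le {m : ℕ} (q : ℂ) (p : MvPolynomial (Fin (m + 1)) ℂ) :
    (punrotate q p).totalDegree ≤ p.totalDegree := by
  refine totalDegree_aeval_le_of_le_one _ (fun i => ?_) p
  refine Fin.cases ?_ (fun i => ?_) i
  · simpa using totalDegree_C_mul_X_le q⁻¹ _
  · simp

theorem totalDegree_pextend_le {m : ℕ} (t : ℂ) (p : MvPolynomial (Fin (m + 1)) ℂ) :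
    (pextend t p).totalDegree ≤ p.totalDegree := by
  refine totalDegree_aeval_le_of_le_one _ (fun i => ?_) p
  refine Fin.lastCases ?_ (fun i => ?_) i
  · simp
  · simpa using totalDegree_C_mul_X_le t _

/-- Unisolvence of interpolation at the spectral vectors. -/
theorem eq_zero_of_eval_spec_eq_zero {q t : ℂ} (hg : Generic q t) :
    ∀ {n : ℕ} (d : ℕ) (f : MvPolynomial (Fin n) ℂ), f.totalDegree ≤ d →
      (∀ v, wt v ≤ d → eval (spec q t v) f = 0) → f = 0 := by
  intro n
  induction n with
  | zero =>
    intro d f _ hv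
    have h0 := hv (fun _ => 0) (by simp [wt])
    rw [eq_C_of_isEmpty f] at h0 ⊢
    simpa using h0
  | succ m ihn =>
    have key : ∀ (d : ℕ) (f : MvPolynomial (Fin (m + 1)) ℂ), f.totalDegree ≤ d →
      (∀ v, wt v ≤ d → eval (spec q t v) f = 0) → (X (Fin.last m) - C 1) ∣ f := by
      intro d f hd hv
      have h0 : pextend t f = 0 := by
        refine ihn d _ ((totalDegree_pextend_le t f).trans hd) fun v hvd => ?_
        rw [eval_pextend, ← spec_app]
        exact hv _ (by rwa [wt_app])
      refine X_sub_C_dvd fun x hx => ?_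
      have h1 : x = extend t (fun i => t⁻¹ * x i.castSucc) := by
        ext i
        have := hg.t_ne
        refine Fin.lastCases ?_ (fun i => ?_) i
        · simp [hx]
        · simp [this]
      rw [h1, ← eval_pextend, h0, map_zero]
    intro d
    induction d with
    | zero =>
      intro f hd hv
      obtain ⟨g, rfl⟩ := key 0 f hd hv
      by_contra hne
      have hg0 : g ≠ 0 := right_ne_zero_of_mul hne
      rw [totalDegree_X_sub_C_mul hg0] at hd
      omega
    | succ d ih =>
      intro f hd hv
      obtain ⟨g, rfl⟩ := key (d + 1) f hd hv
      by_contra hne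
      have hg0 : g ≠ 0 := right_ne_zero_of_mul hne
      rw [totalDegree_X_sub_C_mul hg0] at hd
      have h1 : protate q g = 0 := by
        refine ih _ ((totalDegree_protate_le q g).trans (by omega)) fun v hvd => ?_
        have h2 := hv (phi v) (by rw [wt_phi]; omega)
        rw [map_mul, mul_eq_zero] at h2
        rw [eval_protate, ← spec_phi]
        refine h2.resolve_left ?_
        simpa [sub_eq_zero] using spec_phi_last_ne_one hg v
      apply hg0
      refine MvPolynomial.funext fun x => ?_
      rw [← rot_unrot hg.q_ne x, ← eval_protate, h1]
      simp

theorem eq_of_eval_spec_eq {q t : ℂ} (hg : Generic q t) {d : ℕ} {f g : MvPolynomial (Fin n) ℂ}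
    (hf : f.totalDegree ≤ d) (hgd : g.totalDegree ≤ d)
    (h : ∀ v, wt v ≤ d → eval (spec q t v) f = eval (spec q t v) g) : f = g := by
  rw [← sub_eq_zero]
  refine eq_zero_of_eval_spec_eq_zero hg d _ ((totalDegree_sub f g).trans (max_le hf hgd))
    fun v hv => ?_
  rw [map_sub, h v hv, sub_self]

theorem leg_eq_sum (u : Fin n → ℕ) (i : Fin n) (j : ℕ) :
    leg u i j = ∑ k, if (i < k ∧ j < u k ∧ u k ≤ u i) ∨ (k < i ∧ j ≤ u k ∧ u k < u i)
      then 1 else 0 := by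
  rw [leg, ← Finset.card_filter, ← Finset.card_union_of_disjoint, ← Finset.filter_or]
  rw [Finset.disjoint_filter]
  rintro k - ⟨h1, -⟩ ⟨h2, -⟩
  exact absurd h1 h2.asymm

theorem leg_app_castSucc {m : ℕ} (u : Fin m → ℕ) (i : Fin m) (j : ℕ) :
    leg (app u) i.castSucc j = leg u i j := by
  rw [leg_eq_sum, leg_eq_sum, Fin.sum_univ_castSucc]
  have := (Fin.castSucc_lt_last i).not_gt
  simp [this]

theorem leg_phi_castSucc {m : ℕ} (u : Fin (m + 1) → ℕ) (i : Fin m) (j : ℕ) :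
    leg (phi u) i.castSucc j = leg u i.succ j := by
  rw [leg_eq_sum, leg_eq_sum, Fin.sum_univ_castSucc, Fin.sum_univ_succ (n := m), add_comm]
  congr 1
  · have h1 := (Fin.castSucc_lt_last i)
    simp only [phi_last, phi_castSucc, Fin.succ_pos, h1, h1.not_gt, Fin.not_lt_zero, true_and,
      false_and, or_false, false_or]
    congr 1
    apply propext
    omega
  · simp

theorem leg_phi_last_succ {m : ℕ} (u : Fin (m + 1) → ℕ) (j : ℕ) :
    leg (phi u) (Fin.last m) (j + 1) = leg u 0 j := by
  rw [leg_eq_sum, leg_eq_sum, Fin.sum_univ_castSucc, Fin.sum_univ_succ (n := m)]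
  simp only [lt_irrefl, false_and, or_false, if_false, add_zero, zero_add]
  refine Finset.sum_congr rfl fun k _ => ?_
  have h1 := (Fin.castSucc_lt_last k)
  simp only [phi_last, phi_castSucc, Fin.succ_pos, h1, h1.not_gt, Fin.not_lt_zero, true_and,
      false_and, or_false, false_or]
  congr 1
  apply propext
  omega

theorem leg_phi_last_zero {m : ℕ} (u : Fin (m + 1) → ℕ) :
    leg (phi u) (Fin.last m) 0 = m - lp (phi u) (Fin.last m) := by
  have : leg (phi u) (Fin.last m) 0 + lp (phi u) (Fin.last m) = m := by
    rw [lp_phi_last, lp_eq_sum, leg_eq_sum, Fin.sum_univ_castSucc, Fin.sum_univ_succ (n := m)]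
    simp only [lt_irrefl, false_and, or_false, if_false, add_zero, zero_add, and_false,
      Fin.not_lt_zero]
    rw [← Finset.sum_add_distrib, Finset.sum_congr rfl (g := fun _ => 1)]
    · simp
    intro k _
    have h1 := (Fin.castSucc_lt_last k)
    simp only [phi_last, phi_castSucc, h1, h1.not_gt, true_and,
      false_and, false_or]
    split_ifs <;> omega
  omega

theorem cp_phi {m : ℕ} (q t : ℂ) (u : Fin (m + 1) → ℕ) :
    cp q t (phi u) = cp q t u * (1 - spec q t (phi u) (Fin.last m)) := by
  rw [cp, cp, Fin.prod_univ_castSucc, Fin.prod_univ_succ (n := m)]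
  simp only [phi_last, phi_castSucc, leg_phi_castSucc]
  rw [Finset.prod_range_succ']
  simp only [leg_phi_last_succ, leg_phi_last_zero, spec, phi_last, Nat.add_sub_add_right]
  simp only [Nat.sub_zero, Nat.add_sub_cancel]
  ring

theorem cp_app {m : ℕ} (q t : ℂ) (u : Fin m → ℕ) : cp q t (app u) = cp q t u := by
  rw [cp, cp, Fin.prod_univ_castSucc]
  simp [leg_app_castSucc]

theorem nstat_phi {m : ℕ} (u : Fin (m + 1) → ℕ) :
    nstat (phi u) = nstat u + (m - lp (phi u) (Fin.last m)) := by
  rw [nstat, nstat, Fin.sum_univ_castSucc, Fin.sum_univ_succ (n := m)]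
  simp only [phi_last, phi_castSucc, leg_phi_castSucc]
  rw [Finset.sum_range_succ']
  simp only [leg_phi_last_succ, leg_phi_last_zero]
  ring

theorem nstat_app {m : ℕ} (u : Fin m → ℕ) : nstat (app u) = nstat u := by
  rw [nstat, nstat, Fin.sum_univ_castSucc]
  simp [leg_app_castSucc]

theorem nstat'_phi {m : ℕ} (u : Fin (m + 1) → ℕ) : nstat' (phi u) = nstat' u + u 0 := by
  rw [nstat', nstat', Fin.sum_univ_castSucc, Fin.sum_univ_succ (n := m)]
  simp only [phi_last, phi_castSucc, Nat.choose_succ_succ' (u 0) 1, Nat.choose_one_right]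
  ring

theorem nstat'_app {m : ℕ} (u : Fin m → ℕ) : nstat' (app u) = nstat' u := by
  rw [nstat', nstat', Fin.sum_univ_castSucc]
  simp

theorem cp_ne_zero {q t : ℂ} (hg : Generic q t) (u : Fin n → ℕ) : cp q t u ≠ 0 := by
  rw [cp]
  refine Finset.prod_ne_zero_iff.2 fun i _ => Finset.prod_ne_zero_iff.2 fun j hj => ?_
  rw [Finset.mem_range] at hj
  intro h
  have := (hg.pow_inj (c := 0) (d := 0) (by simpa using (sub_eq_zero.1 h).symm)).1
  omega

/-- The value `𝖬_u(⟨u⟩)`. -/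
def mval (q t : ℂ) (u : Fin n → ℕ) : ℂ :=
  ∏ i, ∏ j ∈ Finset.range (u i), (-(q ^ j * t ^ (n - 1 - lp u i)))

theorem mval_ne_zero {q t : ℂ} (hg : Generic q t) (u : Fin n → ℕ) : mval q t u ≠ 0 :=
  Finset.prod_ne_zero_iff.2 fun _ _ => Finset.prod_ne_zero_iff.2 fun _ _ =>
    neg_ne_zero.2 (mul_ne_zero (pow_ne_zero _ hg.q_ne) (pow_ne_zero _ hg.t_ne))

theorem mval_phi {m : ℕ} (q t : ℂ) (u : Fin (m + 1) → ℕ) :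
    mval q t (phi u) = mval q t u * (-(q ^ u 0 * t ^ (m - lp (phi u) (Fin.last m)))) := by
  rw [mval, mval, Fin.prod_univ_castSucc, Fin.prod_univ_succ (n := m)]
  simp only [phi_last, phi_castSucc, lp_phi_castSucc, lp_phi_last]
  rw [Finset.prod_range_succ]
  simp only [Nat.add_sub_cancel]
  ring

theorem mval_app {m : ℕ} (q t : ℂ) (u : Fin m → ℕ) :
    mval q t (app u) = t ^ wt u * mval q t u := by
  rw [mval, mval, Fin.prod_univ_castSucc, wt, ← Finset.prod_pow_eq_pow_sum,
    ← Finset.prod_mul_distrib]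
  simp only [app_last, app_castSucc, lp_app_castSucc, Finset.range_zero, Finset.prod_empty,
    mul_one]
  refine Finset.prod_congr rfl fun i _ => ?_
  have h := lp_lt u i
  rw [show m + 1 - 1 - lp u i = (m - 1 - lp u i) + 1 by omega]
  have : t ^ u i = ∏ _j ∈ Finset.range (u i), t := by simp
  rw [this, ← Finset.prod_mul_distrib]
  refine Finset.prod_congr rfl fun j _ => ?_
  ring

/-- A rescaled family of interpolation polynomials, normalized by its diagonal values. -/
structure IsNormalized (q t : ℂ) (A : (Fin n → ℕ) → MvPolynomial (Fin n) ℂ) : Prop where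
  deg_le : ∀ u, (A u).totalDegree ≤ wt u
  vanish : ∀ u v, wt v ≤ wt u → v ≠ u → eval (spec q t v) (A u) = 0
  diag : ∀ u, eval (spec q t u) (A u) = mval q t u

theorem coeff_aeval_C_mul_X (s : Fin n → ℂ) (e : Equiv.Perm (Fin n)) (d : Fin n →₀ ℕ)
    (p : MvPolynomial (Fin n) ℂ) :
    coeff (Finsupp.equivMapDomain e d) (aeval (fun i => C (s i) * X (e i)) p) =
      (∏ i, s i ^ d i) * coeff d p := by
  induction p using MvPolynomial.induction_on' with
  | monomial u a =>
    have h : aeval (fun i => C (s i) * X (e i)) (monomial u a) =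
        monomial (Finsupp.equivMapDomain e u) ((∏ i, s i ^ u i) * a) := by
      rw [aeval_monomial, algebraMap_eq, Finsupp.prod_fintype _ _ (by simp), monomial_eq,
        Finsupp.prod_fintype _ _ (by simp)]
      simp only [mul_pow, Finset.prod_mul_distrib, ← C_pow, ← map_prod]
      rw [← Equiv.prod_comp e (fun i => (X i : MvPolynomial (Fin n) ℂ) ^ _)]
      simp only [Finsupp.equivMapDomain_apply, Equiv.symm_apply_apply, C_mul]
      ring
    rw [h, coeff_monomial, coeff_monomial]
    have : (Finsupp.equivMapDomain e u = Finsupp.equivMapDomain e d) ↔ u = d :=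
      (Finsupp.equivCongrLeft e).injective.eq_iff
    simp only [this]
    split_ifs with h'
    · rw [h']
    · simp
  | add p r hp hr => simp only [map_add, coeff_add, hp, hr, mul_add]

theorem coeff_pextend {m : ℕ} (t : ℂ) (u : Fin m → ℕ) (p : MvPolynomial (Fin (m + 1)) ℂ)
    (hp : p.totalDegree ≤ wt u) :
    coeff (Finsupp.equivFunOnFinite.symm u) (pextend t p) =
      t ^ wt u * coeff (Finsupp.equivFunOnFinite.symm (app u)) p := by
  have h : ∀ (d : Fin (m + 1) →₀ ℕ) (a : ℂ), pextend t (monomial d a) =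
      monomial (Finsupp.equivFunOnFinite.symm fun i : Fin m => d i.castSucc)
        (a * t ^ (∑ i : Fin m, d i.castSucc)) := by
    intro d a
    rw [pextend, aeval_monomial, algebraMap_eq, Finsupp.prod_fintype _ _ (by simp), monomial_eq,
      Finsupp.prod_fintype _ _ (by simp), Fin.prod_univ_castSucc]
    simp only [Fin.snoc_castSucc, Fin.snoc_last, one_pow, mul_one, mul_pow,
      Finset.prod_mul_distrib, ← C_pow, ← map_prod, Finset.prod_pow_eq_pow_sum, C_mul]
    simp
    ring
  conv_lhs => rw [p.as_sum, map_sum, coeff_sum]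
  simp only [h, coeff_monomial]
  rw [Finset.sum_eq_single (Finsupp.equivFunOnFinite.symm (app u))]
  · rw [if_pos]
    · simp only [Finsupp.coe_equivFunOnFinite_symm, app_castSucc, wt]
      ring
    · ext i; simp
  · intro d hd hne
    rw [if_neg]
    intro hdu
    apply hne
    have h1 : ∀ i : Fin m, d i.castSucc = u i := fun i => by
      rw [← Finsupp.coe_equivFunOnFinite_symm u, ← hdu]; simp
    have h2 := (le_totalDegree hd).trans hp
    rw [Finsupp.sum_fintype _ _ (by simp), Fin.sum_univ_castSucc, wt] at h2
    simp only [h1] at h2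
    ext i
    refine Fin.lastCases ?_ (fun i => ?_) i
    · simp; omega
    · simp [h1]
  · intro hd
    rw [notMem_support_iff.1 hd]
    simp

/-- The cyclic permutation `0 ↦ last`, `i + 1 ↦ i`. -/
def cyc (m : ℕ) : Equiv.Perm (Fin (m + 1)) := (finRotate (m + 1)).symm

@[simp] theorem cyc_zero {m : ℕ} : cyc m 0 = Fin.last m := by
  rw [cyc, Equiv.symm_apply_eq, finRotate_last]

@[simp] theorem cyc_succ {m : ℕ} (i : Fin m) : cyc m i.succ = i.castSucc := by
  rw [cyc, Equiv.symm_apply_eq, finRotate_apply, Fin.coeSucc_eq_succ]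

theorem punrotate_eq {m : ℕ} (q : ℂ) (p : MvPolynomial (Fin (m + 1)) ℂ) :
    punrotate q p = aeval (fun i => C ((Fin.cons q⁻¹ (fun _ => 1) : Fin (m + 1) → ℂ) i) *
      X (cyc m i)) p := by
  rw [punrotate]
  congr 2
  ext1 i
  refine Fin.cases ?_ (fun i => ?_) i <;> simp

theorem coeff_phi_mul_punrotate {m : ℕ} (q : ℂ) (u : Fin (m + 1) → ℕ)
    (p : MvPolynomial (Fin (m + 1)) ℂ) (hp : p.totalDegree ≤ wt u) :
    coeff (Finsupp.equivFunOnFinite.symm (phi u)) ((X (Fin.last m) - C 1) * punrotate q p) =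
      (q ^ u 0)⁻¹ * coeff (Finsupp.equivFunOnFinite.symm u) p := by
  have h1 : (Finsupp.equivFunOnFinite.symm (phi u)) =
      Finsupp.equivMapDomain (cyc m) (Finsupp.equivFunOnFinite.symm u) +
        Finsupp.single (Fin.last m) 1 := by
    ext i
    obtain ⟨i, rfl⟩ := (cyc m).surjective i
    rw [Finsupp.add_apply, Finsupp.equivMapDomain_apply, Equiv.symm_apply_apply]
    refine Fin.cases ?_ (fun i => ?_) i
    · simp
    · simp [Fin.ext_iff, i.2.ne]
  have h2 : coeff (Finsupp.equivFunOnFinite.symm (phi u)) (punrotate q p) = 0 := by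
    refine coeff_eq_zero_of_totalDegree_lt ?_
    refine ((totalDegree_punrotate_le q p).trans hp).trans_lt ?_
    have := wt_phi u
    rw [Finset.sum_subset (Finset.subset_univ _) (by simp)]
    simp only [Finsupp.coe_equivFunOnFinite_symm]
    simp only [wt] at this ⊢
    omega
  rw [sub_mul, coeff_sub, C_1, one_mul, h2, sub_zero, h1, mul_comm, coeff_mul_X, punrotate_eq,
    coeff_aeval_C_mul_X, Fin.prod_univ_succ]
  simp

theorem eval_spec_self_ne_zero {q t : ℂ} (hg : Generic q t)
    {M : (Fin n → ℕ) → MvPolynomial (Fin n) ℂ} (hM : IsInterpFamily q t M) (u : Fin n → ℕ) :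
    eval (spec q t u) (M u) ≠ 0 := by
  obtain ⟨h1, h2, h3⟩ := hM u
  intro h
  have : M u = 0 := by
    refine eq_zero_of_eval_spec_eq_zero hg _ _ h1 fun v hv => ?_
    by_cases hvu : v = u
    · rw [hvu, h]
    · exact h3 v hv hvu
  rw [this, coeff_zero] at h2
  exact inv_ne_zero (pow_ne_zero _ hg.q_ne) h2.symm

theorem eval_X_last_sub_one_mul_punrotate {m : ℕ} {q t : ℂ} (hg : Generic q t)
    (f : MvPolynomial (Fin (m + 1)) ℂ) (w : Fin (m + 1) → ℕ) :
    eval (spec q t (phi w)) ((X (Fin.last m) - C 1) * punrotate q f) =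
      (spec q t (phi w) (Fin.last m) - 1) * eval (spec q t w) f := by
  rw [map_mul, eval_punrotate, spec_phi, unrot_rot hg.q_ne]
  simp

theorem interp_phi {m : ℕ} {q t : ℂ} (hg : Generic q t)
    {M : (Fin (m + 1) → ℕ) → MvPolynomial (Fin (m + 1)) ℂ} (hM : IsInterpFamily q t M)
    (u : Fin (m + 1) → ℕ) : M (phi u) = (X (Fin.last m) - C 1) * punrotate q (M u) := by
  set P := (X (Fin.last m) - C 1) * punrotate q (M u) with hP
  obtain ⟨h1, h2, h3⟩ := hM u
  obtain ⟨k1, k2, k3⟩ := hM (phi u)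
  have hne := eval_spec_self_ne_zero hg hM (phi u)
  set r := eval (spec q t (phi u)) P / eval (spec q t (phi u)) (M (phi u)) with hr
  have hPr : P = C r * M (phi u) := by
    refine eq_of_eval_spec_eq hg (d := wt (phi u)) ?_ ?_ fun v hv => ?_
    · refine (totalDegree_mul _ _).trans ?_
      rw [totalDegree_X_sub_C, wt_phi, add_comm]
      exact Nat.add_le_add_right ((totalDegree_punrotate_le _ _).trans h1) 1
    · exact (totalDegree_mul _ _).trans (by simpa using k1)
    · rw [map_mul (eval _) (C r), eval_C]
      by_cases hvu : v = phi u
      · rw [hvu, hr, div_mul_cancel₀ _ hne]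
      rw [k3 v hv hvu, mul_zero]
      rcases exists_phi_or_app v with ⟨w, rfl⟩ | ⟨w, rfl⟩
      · rw [hP, eval_X_last_sub_one_mul_punrotate hg, h3 w, mul_zero]
        · rw [wt_phi, wt_phi] at hv; omega
        · rintro rfl; exact hvu rfl
      · rw [hP, map_mul, map_sub, eval_X, spec_app_last]; simp
  have hc := coeff_phi_mul_punrotate q u (M u) h1
  rw [← hP, hPr, coeff_C_mul, k2, h2, nstat'_phi, pow_add, mul_inv, mul_comm] at hc
  have hq : ∀ k, q ^ k ≠ 0 := fun k => pow_ne_zero k hg.q_ne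
  have hr1 : r = 1 := by
    have a := hq (nstat' u); have b := hq (u 0)
    field_simp at hc
    exact hc
  rw [hPr, hr1, C_1, one_mul]

theorem interp_app {m : ℕ} {q t : ℂ} (hg : Generic q t)
    {M : (Fin (m + 1) → ℕ) → MvPolynomial (Fin (m + 1)) ℂ} (hM : IsInterpFamily q t M) :
    IsInterpFamily q t fun u => C (t ^ wt u)⁻¹ * pextend t (M (app u)) := by
  intro u
  obtain ⟨h1, h2, h3⟩ := hM (app u)
  rw [wt_app] at h1 h3
  refine ⟨?_, ?_, fun v hv hvu => ?_⟩
  · refine (totalDegree_mul _ _).trans ?_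
    rw [totalDegree_C, zero_add]
    exact (totalDegree_pextend_le _ _).trans h1
  · rw [coeff_C_mul, coeff_pextend _ _ _ h1, h2, nstat'_app, inv_mul_cancel_left₀]
    exact pow_ne_zero _ hg.t_ne
  · rw [map_mul, eval_pextend, ← spec_app, h3 _ (by rwa [wt_app]) fun h => hvu (app_injective h),
      mul_zero]

theorem normalization {q t : ℂ} (hg : Generic q t) :
    ∀ {n : ℕ} {M : (Fin n → ℕ) → MvPolynomial (Fin n) ℂ}, IsInterpFamily q t M →
      ∀ (d : ℕ) (u : Fin n → ℕ), wt u = d →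
      q ^ nstat' u * t ^ nstat u / cp q t u * eval (spec q t u) (M u) = mval q t u := by
  intro n
  induction n with
  | zero =>
    intro M hM d u _
    obtain ⟨-, h2, -⟩ := hM u
    rw [Subsingleton.elim (Finsupp.equivFunOnFinite.symm u) 0] at h2
    rw [eq_C_of_isEmpty (M u), eval_C, h2]
    simp [nstat', nstat, cp, mval]
  | succ m ihn =>
    intro M hM d
    induction d with
    | zero =>
      intro u hu
      rcases exists_phi_or_app u with ⟨w, rfl⟩ | ⟨w, rfl⟩
      · rw [wt_phi] at hu; omega
      · have := ihn (interp_app hg hM) _ w rfl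
        rw [map_mul, eval_C, eval_pextend, ← spec_app] at this
        rw [mval_app, ← this, cp_app, nstat_app, nstat'_app]
        have := pow_ne_zero (wt w) hg.t_ne
        field_simp
    | succ d ih =>
      intro u hu
      rcases exists_phi_or_app u with ⟨w, rfl⟩ | ⟨w, rfl⟩
      · rw [wt_phi] at hu
        rw [mval_phi, ← ih w (by omega), interp_phi hg hM w, eval_X_last_sub_one_mul_punrotate hg,
          cp_phi, nstat_phi, nstat'_phi]
        have h1 := cp_ne_zero hg w
        have h2 : 1 - spec q t (phi w) (Fin.last m) ≠ 0 :=
          sub_ne_zero.2 (spec_phi_last_ne_one hg w).symm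
        field_simp
        ring
      · have := ihn (interp_app hg hM) _ w rfl
        rw [map_mul, eval_C, eval_pextend, ← spec_app] at this
        rw [mval_app, ← this, cp_app, nstat_app, nstat'_app]
        have := pow_ne_zero (wt w) hg.t_ne
        field_simp

theorem isNormalized_MM {q t : ℂ} (hg : Generic q t)
    {M : (Fin n → ℕ) → MvPolynomial (Fin n) ℂ} (hM : IsInterpFamily q t M) :
    IsNormalized q t (MM q t M) where
  deg_le u := (totalDegree_mul _ _).trans (by simpa using (hM u).1)
  vanish u v h1 h2 := by rw [MM, map_mul, (hM u).2.2 v h1 h2, mul_zero]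
  diag u := by rw [MM, map_mul, eval_C, normalization hg hM _ u rfl]

theorem eval_adj_rename {m : ℕ} (k : Fin m) (x : Fin (m + 1) → ℂ)
    (f : MvPolynomial (Fin (m + 1)) ℂ) : eval x (rename (adj k) f) = eval (x ∘ adj k) f :=
  eval_rename _ _ _

/-- The Demazure–Lusztig operator. -/
theorem exists_hecke {m : ℕ} (t : ℂ) (k : Fin m) (f : MvPolynomial (Fin (m + 1)) ℂ) :
    ∃ g : MvPolynomial (Fin (m + 1)) ℂ, g.totalDegree ≤ f.totalDegree ∧
      (∀ x, (x k.castSucc - x k.succ) * eval x g =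
        (t - 1) * x k.castSucc * eval x f +
          (x k.castSucc - t * x k.succ) * eval (x ∘ adj k) f) ∧
      ∀ x, x k.castSucc = 0 → eval x g = t * eval (x ∘ adj k) f := by
  have hdvd : (X k.castSucc - X k.succ : MvPolynomial (Fin (m + 1)) ℂ) ∣
      f - rename (adj k) f := by
    refine dvd_sub_of_dvd_X_sub (rename (adj k)) _ (fun i => ?_) f
    rw [rename_X]
    simp only [adj, Equiv.swap_apply_def]
    split_ifs with h1 h2
    · rw [h1]
    · rw [h2]; exact ⟨-1, by ring⟩
    · simp
  obtain ⟨g, hg⟩ := hdvd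
  have hev : ∀ x : Fin (m + 1) → ℂ, eval x f - eval (x ∘ adj k) f =
      (x k.castSucc - x k.succ) * eval x g := by
    intro x
    rw [← eval_adj_rename, ← map_sub, hg]
    simp
  have hlin : (X k.castSucc - X k.succ : MvPolynomial (Fin (m + 1)) ℂ) ≠ 0 := by
    intro h
    have := congrArg (eval (Pi.single k.castSucc (1 : ℂ))) h
    simp [Fin.ext_iff] at this
  have hlindeg : (X k.castSucc - X k.succ : MvPolynomial (Fin (m + 1)) ℂ).totalDegree = 1 := by
    refine le_antisymm ((totalDegree_sub _ _).trans (by simp)) ?_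
    by_contra hlt
    have h0 := totalDegree_eq_zero_iff_eq_C.1 (Nat.lt_one_iff.1 (not_le.1 hlt))
    rw [h0] at hlin
    have := congrArg (eval (0 : Fin (m + 1) → ℂ)) h0
    simp only [map_sub, eval_X, Pi.zero_apply, sub_self, eval_C] at this
    rw [← this, C_0] at hlin
    exact hlin rfl
  refine ⟨C t * f - (X k.castSucc - C t * X k.succ) * g, ?_, fun x => ?_, fun x hx => ?_⟩
  · refine (totalDegree_sub _ _).trans (max_le ?_ ?_)
    · exact (totalDegree_mul _ _).trans (by simp)
    · by_cases h0 : g = 0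
      · simp [h0]
      have h1 : (f - rename (adj k) f).totalDegree ≤ f.totalDegree :=
        (totalDegree_sub _ _).trans (max_le le_rfl (totalDegree_rename_le _ _))
      rw [hg, totalDegree_mul_of_isDomain hlin h0, hlindeg] at h1
      refine (totalDegree_mul _ _).trans (le_trans (Nat.add_le_add_right ?_ _) h1)
      exact (totalDegree_sub _ _).trans (max_le (by simp) (totalDegree_C_mul_X_le _ _))
  · have := hev x
    simp only [map_sub, map_mul, eval_X, eval_C]
    linear_combination (x k.castSucc - t * x k.succ) * this
  · have := hev x
    simp only [map_sub, map_mul, eval_X, eval_C, hx]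
    rw [hx] at this
    linear_combination (t) * this

theorem exists_hecke_spec {m : ℕ} {q t : ℂ} (hg : Generic q t) (k : Fin m)
    {f g : MvPolynomial (Fin (m + 1)) ℂ}
    (h : ∀ x, (x k.castSucc - x k.succ) * eval x g =
        (t - 1) * x k.castSucc * eval x f +
          (x k.castSucc - t * x k.succ) * eval (x ∘ adj k) f) (w : Fin (m + 1) → ℕ)
    (h1 : eval (spec q t w) f = 0) (h2 : eval (spec q t (w ∘ adj k)) f = 0) :
    eval (spec q t w) g = 0 := by
  have h3 := h (spec q t w)
  have hne : spec q t w k.castSucc - spec q t w k.succ ≠ 0 := by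
    rw [sub_ne_zero]
    intro h
    have := spec_apply_injective hg w h
    simp [Fin.ext_iff] at this
  rw [h1, mul_zero, zero_add] at h3
  refine (mul_eq_zero.1 (h3.trans ?_)).resolve_left hne
  by_cases hw : w k.castSucc = w k.succ
  · rw [spec_castSucc_of_eq q t w k hw, sub_self, zero_mul]
  · rw [← spec_comp_adj q t w k hw, h2, mul_zero]

theorem exists_hecke_cycle {m : ℕ} {q t : ℂ} (hg : Generic q t)
    (f : MvPolynomial (Fin (m + 1)) ℂ) (j : Fin (m + 1)) :
    ∃ S : MvPolynomial (Fin (m + 1)) ℂ, S.totalDegree ≤ f.totalDegree ∧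
      (∀ w, (∀ σ : Equiv.Perm (Fin (m + 1)), eval (spec q t (w ∘ σ)) f = 0) →
        eval (spec q t w) S = 0) ∧
      ∀ x : Fin (m + 1) → ℂ, x j = 0 → eval x S = t ^ (m - j : ℕ) *
        eval (Fin.snoc (α := fun _ => ℂ) (fun i => x (j.succAbove i)) 0) f := by
  induction j using Fin.reverseInduction with
  | last =>
    refine ⟨f, le_rfl, fun w hw => by simpa using hw 1, fun x hx => ?_⟩
    simp only [Fin.val_last, Nat.sub_self, pow_zero, one_mul]
    congr 2
    ext i
    refine Fin.lastCases ?_ (fun i => ?_) i <;> simp [hx]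
  | cast k ih =>
    obtain ⟨S, h1, h2, h3⟩ := ih
    obtain ⟨g, k1, k2, k3⟩ := exists_hecke t k S
    refine ⟨g, k1.trans h1, fun w hw => ?_, fun x hx => ?_⟩
    · refine exists_hecke_spec hg k k2 w (h2 w hw) (h2 _ fun σ => ?_)
      exact hw (σ.trans (adj k))
    · rw [k3 x hx, h3 _ (by simpa using hx), ← mul_assoc, ← pow_succ']
      congr 2
      · simp only [Fin.val_succ, Fin.val_castSucc]; omega
      · congr 2
        ext i
        simp only [Function.comp]
        congr 1
        ext
        simp only [adj, Equiv.swap_apply_def, Fin.succAbove, Fin.ext_iff, Fin.lt_def]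
        split_ifs <;> simp_all <;> omega

theorem totalDegree_C_mul_le (a : ℂ) (p : MvPolynomial (Fin n) ℂ) :
    (C a * p).totalDegree ≤ p.totalDegree := by
  simpa using totalDegree_mul (C a) p

theorem IsNormalized.last_eq_or_exists {m : ℕ} {q t : ℂ} (hg : Generic q t)
    {A : (Fin (m + 1) → ℕ) → MvPolynomial (Fin (m + 1)) ℂ} (hA : IsNormalized q t A)
    {v w : Fin (m + 1) → ℕ} (h : eval (spec q t w) (A v) ≠ 0) :
    spec q t w (Fin.last m) = spec q t v (Fin.last m) ∨
      ∃ (w' : Fin (m + 1) → ℕ) (σ : Equiv.Perm (Fin (m + 1))), w = phi w' ∧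
        eval (spec q t (w' ∘ σ)) (A v) ≠ 0 := by
  obtain ⟨S, hS1, hS2, hS3⟩ := exists_hecke_cycle hg (A v) 0
  have htm : t ^ m ≠ 0 := pow_ne_zero _ hg.t_ne
  set g := A v + C (t ^ m)⁻¹ * ((X (Fin.last m) - C 1) * punrotate q S) with hgdef
  have hgx : ∀ x, eval x g = eval x (A v) + (t ^ m)⁻¹ * ((x (Fin.last m) - 1) *
      eval (unrot q x) S) := by
    intro x; simp [hgdef]
  have hdvd : (X (Fin.last m) - C 0) ∣ g := by
    refine X_sub_C_dvd fun x hx => ?_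
    rw [hgx, hS3 _ (by simp [hx]), hx]
    have : (Fin.snoc (α := fun _ => ℂ) (fun i => unrot q x ((0 : Fin (m + 1)).succAbove i)) 0) =
        x := by
      ext i
      refine Fin.lastCases ?_ (fun i => ?_) i <;> simp [hx]
    rw [this]
    simp only [Fin.val_zero, Nat.sub_zero]
    field_simp
    ring
  obtain ⟨p, hp⟩ := hdvd
  have hpx : ∀ x, x (Fin.last m) * eval x p = eval x (A v) + (t ^ m)⁻¹ * ((x (Fin.last m) - 1) *
      eval (unrot q x) S) := by
    intro x; rw [← hgx, hp]; simp
  have hspec : ∀ w, (∀ w', w = phi w' → ∀ σ : Equiv.Perm (Fin (m + 1)),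
      eval (spec q t (w' ∘ σ)) (A v) = 0) →
      spec q t w (Fin.last m) * eval (spec q t w) p = eval (spec q t w) (A v) := by
    intro w hw
    rw [hpx]
    rcases exists_phi_or_app w with ⟨w', rfl⟩ | ⟨w', rfl⟩
    · rw [spec_phi, unrot_rot hg.q_ne, hS2 _ (hw w' rfl)]; simp
    · rw [spec_app_last]; simp
  have hpdeg : p.totalDegree ≤ wt v := by
    by_cases hp0 : p = 0
    · simp [hp0]
    have h1 : g.totalDegree ≤ wt v + 1 := by
      refine (totalDegree_add _ _).trans (max_le ((hA.deg_le v).trans (Nat.le_succ _)) ?_)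
      refine (totalDegree_C_mul_le _ _).trans ((totalDegree_mul _ _).trans ?_)
      rw [totalDegree_X_sub_C, add_comm]
      exact Nat.add_le_add_right
        ((totalDegree_punrotate_le _ _).trans (hS1.trans (hA.deg_le v))) 1
    rw [hp, totalDegree_X_sub_C_mul hp0] at h1
    omega
  have hpeq : p = C (spec q t v (Fin.last m))⁻¹ * A v := by
    refine eq_of_eval_spec_eq hg hpdeg ((totalDegree_C_mul_le _ _).trans (hA.deg_le v))
      fun w hw => ?_
    have h1 := hspec w fun w' hw' σ => hA.vanish _ _ ?_ ?_
    · rw [map_mul, eval_C]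
      have h2 := spec_ne_zero hg w (Fin.last m)
      by_cases hwv : w = v
      · subst hwv
        rw [← h1, inv_mul_cancel_left₀ h2]
      · rw [hA.vanish v w hw hwv] at h1 ⊢
        rw [mul_zero]
        exact (mul_eq_zero.1 h1).resolve_left h2
    · rw [hw', wt_phi] at hw
      rw [wt_comp]; omega
    · intro h
      rw [← h, wt_comp, hw', wt_phi] at hw
      omega
  by_contra hcon
  push Not at hcon
  obtain ⟨hc1, hc2⟩ := hcon
  have h1 := hspec w fun w' hw' σ => hc2 w' σ hw'
  rw [hpeq, map_mul, eval_C] at h1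
  have h2 := spec_ne_zero hg v (Fin.last m)
  apply hc1
  field_simp at h1
  exact h1

theorem IsNormalized.phi {m : ℕ} {q t : ℂ} (hg : Generic q t)
    {A : (Fin (m + 1) → ℕ) → MvPolynomial (Fin (m + 1)) ℂ} (hA : IsNormalized q t A)
    (u : Fin (m + 1) → ℕ) :
    C (spec q t (phi u) (Fin.last m) - 1) * A (LRW.phi u) =
      C (-(q ^ u 0 * t ^ (m - lp (LRW.phi u) (Fin.last m)))) *
        ((X (Fin.last m) - C 1) * punrotate q (A u)) := by
  refine eq_of_eval_spec_eq hg (d := wt (LRW.phi u))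
    ((totalDegree_C_mul_le _ _).trans (hA.deg_le _)) ?_ fun v hv => ?_
  · refine (totalDegree_C_mul_le _ _).trans ((totalDegree_mul _ _).trans ?_)
    rw [totalDegree_X_sub_C, add_comm, wt_phi]
    exact Nat.add_le_add_right ((totalDegree_punrotate_le _ _).trans (hA.deg_le u)) 1
  · rw [map_mul, map_mul (eval _) (C (-_)), eval_C, eval_C]
    rcases exists_phi_or_app v with ⟨w, rfl⟩ | ⟨w, rfl⟩
    · rw [eval_X_last_sub_one_mul_punrotate hg]
      by_cases hwu : w = u
      · subst hwu
        rw [hA.diag, hA.diag, mval_phi]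
        ring
      · rw [wt_phi, wt_phi] at hv
        rw [hA.vanish u w (by omega) hwu, hA.vanish _ _ (by rw [wt_phi, wt_phi]; exact hv)
          (phi_injective.ne hwu)]
        ring
    · rw [hA.vanish _ _ hv (app_ne_phi _ _), map_mul, map_sub, eval_X, spec_app_last]
      simp

theorem IsNormalized.restrict {m : ℕ} {q t : ℂ} (hg : Generic q t)
    {A : (Fin (m + 1) → ℕ) → MvPolynomial (Fin (m + 1)) ℂ} (hA : IsNormalized q t A) :
    IsNormalized q t fun u => C (t ^ wt u)⁻¹ * pextend t (A (app u)) where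
  deg_le u := (totalDegree_C_mul_le _ _).trans
    ((totalDegree_pextend_le _ _).trans ((hA.deg_le _).trans_eq (wt_app u)))
  vanish u v h1 h2 := by
    rw [map_mul, eval_pextend, ← spec_app, hA.vanish _ _ (by rwa [wt_app, wt_app])
      (app_injective.ne h2), mul_zero]
  diag u := by
    rw [map_mul, eval_C, eval_pextend, ← spec_app, hA.diag, mval_app,
      inv_mul_cancel_left₀ (pow_ne_zero _ hg.t_ne)]

/-- The number of entries of `u` that are at least `c`. -/
def cnt (u : Fin n → ℕ) (c : ℕ) : ℕ := ∑ i, if c ≤ u i then 1 else 0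

theorem cnt_comp (u : Fin n → ℕ) (σ : Equiv.Perm (Fin n)) (c : ℕ) : cnt (u ∘ σ) c = cnt u c :=
  Equiv.sum_comp σ fun i => if c ≤ u i then 1 else 0

theorem cnt_phi {m : ℕ} (u : Fin (m + 1) → ℕ) (c : ℕ) :
    cnt (phi u) c = cnt u c + if c = u 0 + 1 then 1 else 0 := by
  rw [cnt, cnt, Fin.sum_univ_castSucc, Fin.sum_univ_succ (n := m)]
  simp only [phi_castSucc, phi_last]
  split_ifs <;> omega

theorem cnt_app {m : ℕ} (u : Fin m → ℕ) (c : ℕ) :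
    cnt (app u) c = cnt u c + if c = 0 then 1 else 0 := by
  rw [cnt, cnt, Fin.sum_univ_castSucc]
  simp

/-- The extra vanishing property. -/
theorem IsNormalized.cnt_le_of_ne_zero {q t : ℂ} (hg : Generic q t) :
    ∀ {n : ℕ} {A : (Fin n → ℕ) → MvPolynomial (Fin n) ℂ}, IsNormalized q t A →
      ∀ (d : ℕ) (v w : Fin n → ℕ), wt w = d → eval (spec q t w) (A v) ≠ 0 →
      ∀ c, cnt v c ≤ cnt w c := by
  intro n
  induction n with
  | zero => intro A _ d v w _ _ c; simp [cnt]
  | succ m ihn =>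
    intro A hA d
    induction d using Nat.strong_induction_on with
    | _ d ih =>
      intro v w hw h c
      rcases hA.last_eq_or_exists hg h with h1 | ⟨w', σ, rfl, h1⟩
      · have h2 := (hg.pow_inj h1).1
        rcases exists_phi_or_app v with ⟨v, rfl⟩ | ⟨v, rfl⟩ <;>
        rcases exists_phi_or_app w with ⟨w, rfl⟩ | ⟨w, rfl⟩
        · rw [phi_last, phi_last] at h2
          rw [cnt_phi, cnt_phi, h2]
          refine Nat.add_le_add_right (ih (wt w) (by rw [← hw, wt_phi]; omega) v w rfl ?_ c) _
          intro h0
          have h3 := congrArg (eval (spec q t (LRW.phi w))) (hA.phi hg v)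
          rw [map_mul, map_mul _ (C (-_)), eval_X_last_sub_one_mul_punrotate hg, h0, eval_C,
            mul_zero, mul_zero, mul_eq_zero, sub_eq_zero] at h3
          exact h3.elim (spec_phi_last_ne_one hg v) h
        · simp at h2
        · simp at h2
        · rw [cnt_app, cnt_app]
          refine Nat.add_le_add_right (ihn (hA.restrict hg) _ v w rfl ?_ c) _
          rw [map_mul, eval_pextend, ← spec_app, eval_C]
          exact mul_ne_zero (inv_ne_zero (pow_ne_zero _ hg.t_ne)) h
      · refine (ih (wt (w' ∘ σ)) ?_ v _ rfl h1 c).trans ?_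
        · rw [wt_comp, ← hw, wt_phi]; omega
        · rw [cnt_comp, cnt_phi]; omega

theorem image_lp_filter (u : Fin n → ℕ) (c : ℕ) :
    (Finset.univ.filter fun i => c ≤ u i).image (lp u) = Finset.range (cnt u c) := by
  refine Finset.eq_of_subset_of_card_le (fun r hr => ?_) ?_
  · obtain ⟨i, hi, rfl⟩ := Finset.mem_image.1 hr
    simp only [Finset.mem_filter, Finset.mem_univ, true_and] at hi
    rw [Finset.mem_range, lp_eq_card, cnt, ← Finset.card_filter]
    refine Finset.card_lt_card
      ((Finset.ssubset_iff_of_subset fun k => ?_).2 ⟨i, by simp [hi], by simp⟩)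
    simp only [Finset.mem_filter, Finset.mem_univ, true_and]
    omega
  · rw [Finset.card_image_of_injective _ (lp_injective u), Finset.card_range, cnt,
      Finset.card_filter]

theorem prod_cells_eq {R : Type*} [CommMonoid R] (g : ℕ → ℕ → R) (u : Fin n → ℕ) {D : ℕ}
    (hD : ∀ i, u i ≤ D) :
    ∏ i, ∏ j ∈ Finset.range (u i), g j (lp u i) =
      ∏ j ∈ Finset.range D, ∏ r ∈ Finset.range (cnt u (j + 1)), g j r := by
  have h1 : ∀ i, ∏ j ∈ Finset.range (u i), g j (lp u i) =
      ∏ j ∈ Finset.range D, if j + 1 ≤ u i then g j (lp u i) else 1 := by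
    intro i
    rw [← Finset.prod_filter]
    refine Finset.prod_congr ?_ fun _ _ => rfl
    ext j
    have := hD i
    simp only [Finset.mem_filter, Finset.mem_range]
    omega
  rw [Finset.prod_congr rfl fun i _ => h1 i, Finset.prod_comm]
  refine Finset.prod_congr rfl fun j _ => ?_
  rw [← Finset.prod_filter, ← image_lp_filter,
    Finset.prod_image fun a _ b _ h => lp_injective u h]

theorem prod_lp_eq {R : Type*} [CommMonoid R] (g : ℕ → R) (u : Fin n → ℕ) :
    ∏ i, g (lp u i) = ∏ r ∈ Finset.range n, g r := by
  have h := image_lp_filter u 0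
  have h2 : cnt u 0 = n := by simp [cnt]
  rw [h2] at h
  rw [← h, Finset.prod_image fun a _ b _ h => lp_injective u h]
  simp

theorem le_wt (u : Fin n → ℕ) (i : Fin n) : u i ≤ wt u :=
  Finset.single_le_sum (f := u) (fun _ _ => Nat.zero_le _) (Finset.mem_univ i)

/-- The shifted factorial `(s t^{n-1})_u` as a polynomial in `s`. -/
def cpoly (q t : ℂ) (u : Fin n → ℕ) : Polynomial ℂ :=
  ∏ i, ∏ j ∈ Finset.range (u i), (1 - Polynomial.C (q ^ j * t ^ (n - 1 - lp u i)) * Polynomial.X)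

/-- The shifted factorial `(s t^{n-1})_u`. -/
def cfac (q t s : ℂ) (u : Fin n → ℕ) : ℂ :=
  ∏ i, ∏ j ∈ Finset.range (u i), (1 - s * (q ^ j * t ^ (n - 1 - lp u i)))

theorem eval_cpoly (q t s : ℂ) (u : Fin n → ℕ) : (cpoly q t u).eval s = cfac q t s u := by
  simp only [cpoly, cfac, Polynomial.eval_prod, Polynomial.eval_sub, Polynomial.eval_one,
    Polynomial.eval_mul, Polynomial.eval_C, Polynomial.eval_X, mul_comm s]

theorem qfac_mul_pow {q t : ℂ} (ht : t ≠ 0) (s : ℂ) (u : Fin n → ℕ) :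
    qfac q t (s * t ^ (n - 1)) u = cfac q t s u := by
  refine Finset.prod_congr rfl fun i _ => Finset.prod_congr rfl fun j _ => ?_
  have h := lp_lt u i
  have h2 : t ^ (n - 1) = t ^ (n - 1 - lp u i) * t ^ lp u i := by
    rw [← pow_add]; congr 1; omega
  have h3 := pow_ne_zero (lp u i) ht
  rw [h2]
  field_simp

theorem cpoly_dvd (q t : ℂ) {v w : Fin n → ℕ} (h : ∀ c, cnt v c ≤ cnt w c) :
    cpoly q t v ∣ cpoly q t w := by
  have h1 := prod_cells_eq (fun j r => 1 - Polynomial.C (q ^ j * t ^ (n - 1 - r)) * Polynomial.X)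
    v (D := wt v + wt w) fun i => (le_wt v i).trans (Nat.le_add_right _ _)
  have h2 := prod_cells_eq (fun j r => 1 - Polynomial.C (q ^ j * t ^ (n - 1 - r)) * Polynomial.X)
    w (D := wt v + wt w) fun i => (le_wt w i).trans (Nat.le_add_left _ _)
  rw [cpoly, cpoly, h1, h2]
  exact Finset.prod_dvd_prod_of_dvd _ _ fun j _ =>
    Finset.prod_dvd_prod_of_subset _ _ _ (Finset.range_subset_range.2 (h _))

theorem coeff_zero_cpoly (q t : ℂ) (u : Fin n → ℕ) : (cpoly q t u).coeff 0 = 1 := by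
  rw [Polynomial.coeff_zero_eq_eval_zero, eval_cpoly]
  simp [cfac]

theorem cpoly_ne_zero (q t : ℂ) (u : Fin n → ℕ) : cpoly q t u ≠ 0 := by
  intro h
  have := coeff_zero_cpoly q t u
  rw [h] at this
  simp at this

theorem natDegree_one_sub_C_mul_X {a : ℂ} (ha : a ≠ 0) :
    (1 - Polynomial.C a * Polynomial.X : Polynomial ℂ).natDegree = 1 := by
  have h : (1 - Polynomial.C a * Polynomial.X : Polynomial ℂ) =
      Polynomial.C (-a) * Polynomial.X + Polynomial.C 1 := by
    rw [Polynomial.C_neg, Polynomial.C_1]; ring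
  rw [h, Polynomial.natDegree_linear (neg_ne_zero.2 ha)]

theorem leadingCoeff_one_sub_C_mul_X {a : ℂ} (ha : a ≠ 0) :
    (1 - Polynomial.C a * Polynomial.X : Polynomial ℂ).leadingCoeff = -a := by
  have h : (1 - Polynomial.C a * Polynomial.X : Polynomial ℂ) =
      Polynomial.C (-a) * Polynomial.X + Polynomial.C 1 := by
    rw [Polynomial.C_neg, Polynomial.C_1]; ring
  rw [h, Polynomial.leadingCoeff_linear (neg_ne_zero.2 ha)]

theorem natDegree_cpoly {q t : ℂ} (hg : Generic q t) (u : Fin n → ℕ) :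
    (cpoly q t u).natDegree = wt u := by
  have hne : ∀ j r : ℕ, q ^ j * t ^ r ≠ 0 := fun j r =>
    mul_ne_zero (pow_ne_zero _ hg.q_ne) (pow_ne_zero _ hg.t_ne)
  have hne2 : ∀ j r : ℕ, (1 - Polynomial.C (q ^ j * t ^ r) * Polynomial.X : Polynomial ℂ) ≠ 0 := by
    intro j r h
    have := natDegree_one_sub_C_mul_X (hne j r)
    rw [h] at this
    simp at this
  rw [cpoly, Polynomial.natDegree_prod _ _ fun i _ => Finset.prod_ne_zero_iff.2 fun j _ => hne2 _ _]
  refine Finset.sum_congr rfl fun i _ => ?_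
  rw [Polynomial.natDegree_prod _ _ fun j _ => hne2 _ _]
  rw [Finset.sum_congr rfl fun j _ => natDegree_one_sub_C_mul_X (hne _ _)]
  simp

theorem leadingCoeff_cpoly {q t : ℂ} (hg : Generic q t) (u : Fin n → ℕ) :
    (cpoly q t u).leadingCoeff = mval q t u := by
  simp only [cpoly, mval, Polynomial.leadingCoeff_prod]
  refine Finset.prod_congr rfl fun i _ => Finset.prod_congr rfl fun j _ => ?_
  exact leadingCoeff_one_sub_C_mul_X
    (mul_ne_zero (pow_ne_zero _ hg.q_ne) (pow_ne_zero _ hg.t_ne))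

/-- The polynomial `∏ᵢ (1 - xᵢ X)`. -/
def epoly (x : Fin n → ℂ) : Polynomial ℂ := ∏ i, (1 - Polynomial.C (x i) * Polynomial.X)

theorem coeff_zero_epoly (x : Fin n → ℂ) : (epoly x).coeff 0 = 1 := by
  simp [epoly, Polynomial.coeff_zero_eq_eval_zero, Polynomial.eval_prod]

theorem cpoly_mul_epoly (q t : ℂ) (u : Fin n → ℕ) :
    cpoly q t u * epoly (spec q t u) =
      (∏ r ∈ Finset.range n, (1 - Polynomial.C (t ^ (n - 1 - r)) * Polynomial.X)) *
        (cpoly q t u).comp (Polynomial.C q * Polynomial.X) := by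
  rw [← prod_lp_eq (fun r => 1 - Polynomial.C (t ^ (n - 1 - r)) * Polynomial.X) u, cpoly, epoly,
    Polynomial.prod_comp, ← Finset.prod_mul_distrib, ← Finset.prod_mul_distrib]
  refine Finset.prod_congr rfl fun i _ => ?_
  rw [Polynomial.prod_comp, spec, ← Finset.prod_range_succ
    (fun j => 1 - Polynomial.C (q ^ j * t ^ (n - 1 - lp u i)) * Polynomial.X),
    Finset.prod_range_succ', mul_comm]
  congr 1
  · simp
  · refine Finset.prod_congr rfl fun j _ => ?_
    simp only [Polynomial.sub_comp, Polynomial.one_comp, Polynomial.mul_comp, Polynomial.C_comp,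
      Polynomial.X_comp, pow_succ, Polynomial.C_mul]
    ring

/-- The generic version of `epoly`. -/
def epolyMv (n : ℕ) : Polynomial (MvPolynomial (Fin n) ℂ) :=
  ∏ i, (1 - Polynomial.C (X i) * Polynomial.X)

theorem eval_coeff_epolyMv (x : Fin n → ℂ) (j : ℕ) :
    eval x ((epolyMv n).coeff j) = (epoly x).coeff j := by
  have : (epolyMv n).map (eval x) = epoly x := by
    simp [epolyMv, epoly, Polynomial.map_prod]
  rw [← this, Polynomial.coeff_map]

theorem totalDegree_coeff_epolyMv_le (j : ℕ) : ((epolyMv n).coeff j).totalDegree ≤ j := by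
  have key : ∀ s : Finset (Fin n), ∀ j, ((∏ i ∈ s, (1 - Polynomial.C (X i) * Polynomial.X) :
      Polynomial (MvPolynomial (Fin n) ℂ)).coeff j).totalDegree ≤ j := by
    intro s
    induction s using Finset.induction_on with
    | empty =>
      intro j
      rw [Finset.prod_empty, Polynomial.coeff_one]
      split_ifs <;> simp
    | insert a s ha ih =>
      intro j
      rw [Finset.prod_insert ha, sub_mul, one_mul, mul_assoc, Polynomial.coeff_sub,
        Polynomial.coeff_C_mul]
      refine (totalDegree_sub _ _).trans (max_le (ih j) ?_)
      rcases j with _ | j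
      · rw [Polynomial.coeff_X_mul_zero]; simp
      · refine (totalDegree_mul _ _).trans ?_
        rw [Polynomial.coeff_X_mul, totalDegree_X, add_comm]
        exact Nat.add_le_add_right (ih j) 1
  exact key _ j

theorem IsNormalized.exists_quot {q t : ℂ} (hg : Generic q t)
    {A : (Fin n → ℕ) → MvPolynomial (Fin n) ℂ} (hA : IsNormalized q t A) (v w : Fin n → ℕ) :
    ∃ r : Polynomial ℂ, Polynomial.C (eval (spec q t w) (A v)) * cpoly q t w = cpoly q t v * r := by
  by_cases h : eval (spec q t w) (A v) = 0
  · exact ⟨0, by rw [h]; simp⟩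
  · obtain ⟨r, hr⟩ := cpoly_dvd q t (hA.cnt_le_of_ne_zero hg _ v w rfl h)
    exact ⟨Polynomial.C (eval (spec q t w) (A v)) * r, by rw [hr]; ring⟩

/-- `𝖬_v(⟨w⟩)` times the ratio of the shifted factorials of `w` and `v`, as a polynomial. -/
def quot (q t : ℂ) (A : (Fin n → ℕ) → MvPolynomial (Fin n) ℂ) (v w : Fin n → ℕ) : Polynomial ℂ :=
  Polynomial.C (eval (spec q t w) (A v)) * cpoly q t w / cpoly q t v

theorem IsNormalized.cpoly_mul_quot {q t : ℂ} (hg : Generic q t)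
    {A : (Fin n → ℕ) → MvPolynomial (Fin n) ℂ} (hA : IsNormalized q t A) (v w : Fin n → ℕ) :
    cpoly q t v * quot q t A v w = Polynomial.C (eval (spec q t w) (A v)) * cpoly q t w := by
  obtain ⟨r, hr⟩ := hA.exists_quot hg v w
  rw [quot, hr, mul_div_cancel_left₀ _ (cpoly_ne_zero q t v)]

theorem IsNormalized.quot_mul_epoly {q t : ℂ} (hg : Generic q t)
    {A : (Fin n → ℕ) → MvPolynomial (Fin n) ℂ} (hA : IsNormalized q t A) (v w : Fin n → ℕ) :
    quot q t A v w * epoly (spec q t w) =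
      (quot q t A v w).comp (Polynomial.C q * Polynomial.X) * epoly (spec q t v) := by
  have h1 := hA.cpoly_mul_quot hg v w
  have h2 := congrArg (fun p => p.comp (Polynomial.C q * Polynomial.X)) h1
  simp only [Polynomial.mul_comp, Polynomial.C_comp] at h2
  have h3 := cpoly_mul_epoly q t v
  have h4 := cpoly_mul_epoly q t w
  refine mul_left_cancel₀ (cpoly_ne_zero q t v) ?_
  linear_combination (epoly (spec q t w)) * h1 + Polynomial.C (eval (spec q t w) (A v)) * h4 -
    (∏ r ∈ Finset.range n, (1 - Polynomial.C (t ^ (n - 1 - r)) * Polynomial.X)) * h2 -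
    (quot q t A v w).comp (Polynomial.C q * Polynomial.X) * h3

theorem IsNormalized.coeff_zero_quot {q t : ℂ} (hg : Generic q t)
    {A : (Fin n → ℕ) → MvPolynomial (Fin n) ℂ} (hA : IsNormalized q t A) (v w : Fin n → ℕ) :
    (quot q t A v w).coeff 0 = eval (spec q t w) (A v) := by
  have h := congrArg (fun p => p.coeff 0) (hA.cpoly_mul_quot hg v w)
  simpa [Polynomial.mul_coeff_zero, coeff_zero_cpoly] using h

theorem IsNormalized.coeff_quot_eq_zero {q t : ℂ} (hg : Generic q t)
    {A : (Fin n → ℕ) → MvPolynomial (Fin n) ℂ} (hA : IsNormalized q t A) (v w : Fin n → ℕ)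
    {k : ℕ} (h : wt w < wt v + k) : (quot q t A v w).coeff k = 0 := by
  by_cases h0 : eval (spec q t w) (A v) = 0
  · rw [quot, h0]; simp
  have h1 := congrArg Polynomial.natDegree (hA.cpoly_mul_quot hg v w)
  have h2 : quot q t A v w ≠ 0 := by
    intro h3
    have := hA.coeff_zero_quot hg v w
    rw [h3, Polynomial.coeff_zero] at this
    exact h0 this.symm
  rw [Polynomial.natDegree_mul (cpoly_ne_zero _ _ _) h2, Polynomial.natDegree_C_mul h0,
    natDegree_cpoly hg, natDegree_cpoly hg] at h1
  exact Polynomial.coeff_eq_zero_of_natDegree_lt (by omega)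

theorem IsNormalized.coeff_quot_top {q t : ℂ} (hg : Generic q t)
    {A : (Fin n → ℕ) → MvPolynomial (Fin n) ℂ} (hA : IsNormalized q t A) (v w : Fin n → ℕ)
    {k : ℕ} (h : wt w = wt v + k) :
    mval q t v * (quot q t A v w).coeff k = eval (spec q t w) (A v) * mval q t w := by
  by_cases h0 : eval (spec q t w) (A v) = 0
  · rw [quot, h0]; simp
  have h1 := hA.cpoly_mul_quot hg v w
  have h2 : quot q t A v w ≠ 0 := by
    intro h3
    have := hA.coeff_zero_quot hg v w
    rw [h3, Polynomial.coeff_zero] at this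
    exact h0 this.symm
  have h4 := congrArg Polynomial.natDegree h1
  rw [Polynomial.natDegree_mul (cpoly_ne_zero _ _ _) h2, Polynomial.natDegree_C_mul h0,
    natDegree_cpoly hg, natDegree_cpoly hg] at h4
  have h5 : (quot q t A v w).natDegree = k := by omega
  have h6 := congrArg Polynomial.leadingCoeff h1
  rw [Polynomial.leadingCoeff_mul, Polynomial.leadingCoeff_mul, Polynomial.leadingCoeff_C,
    leadingCoeff_cpoly hg, leadingCoeff_cpoly hg, Polynomial.leadingCoeff, h5] at h6
  exact h6

theorem IsNormalized.exists_poly_coeff_quot {q t : ℂ} (hg : Generic q t)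
    {A : (Fin n → ℕ) → MvPolynomial (Fin n) ℂ} (hA : IsNormalized q t A) (v : Fin n → ℕ) (k : ℕ) :
    ∃ p : MvPolynomial (Fin n) ℂ, p.totalDegree ≤ wt v + k ∧
      ∀ w, eval (spec q t w) p = (quot q t A v w).coeff k := by
  induction k using Nat.strong_induction_on with
  | _ k ih =>
    rcases k with _ | k
    · exact ⟨A v, hA.deg_le v, fun w => (hA.coeff_zero_quot hg v w).symm⟩
    choose! p hp1 hp2 using ih
    have hqk : 1 - q ^ (k + 1) ≠ 0 := by
      rw [sub_ne_zero]
      intro h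
      have := (hg.pow_inj (a := 0) (b := 0) (c := k + 1) (d := 0) (by simpa using h)).1
      omega
    refine ⟨C (1 - q ^ (k + 1))⁻¹ * ∑ j ∈ Finset.range (k + 1),
      (C ((epoly (spec q t v)).coeff (j + 1) * q ^ (k - j)) - (epolyMv n).coeff (j + 1)) *
        p (k - j), ?_, fun w => ?_⟩
    · refine (totalDegree_C_mul_le _ _).trans (totalDegree_finsetSum_le fun j hj => ?_)
      rw [Finset.mem_range] at hj
      refine (totalDegree_mul _ _).trans ?_
      have h1 := hp1 (k - j) (by omega)
      have h2 : (C ((epoly (spec q t v)).coeff (j + 1) * q ^ (k - j)) -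
          (epolyMv n).coeff (j + 1)).totalDegree ≤ j + 1 :=
        (totalDegree_sub _ _).trans
          (max_le (by rw [totalDegree_C]; omega) (totalDegree_coeff_epolyMv_le _))
      omega
    · rw [map_mul, eval_C, map_sum, inv_mul_eq_iff_eq_mul₀ hqk]
      have h := congrArg (fun p => p.coeff (k + 1)) (hA.quot_mul_epoly hg v w)
      simp only [mul_comm _ (epoly _), Polynomial.coeff_mul] at h
      rw [Finset.Nat.sum_antidiagonal_eq_sum_range_succ_mk,
        Finset.Nat.sum_antidiagonal_eq_sum_range_succ_mk, Finset.sum_range_succ',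
        Finset.sum_range_succ' _ (k + 1)] at h
      simp only [Polynomial.comp_C_mul_X_coeff, coeff_zero_epoly, Nat.sub_zero, one_mul,
        Nat.add_sub_add_right] at h
      have h3 : ∑ j ∈ Finset.range (k + 1), eval (spec q t w)
          ((C ((epoly (spec q t v)).coeff (j + 1) * q ^ (k - j)) - (epolyMv n).coeff (j + 1)) *
          p (k - j)) = ∑ j ∈ Finset.range (k + 1), (epoly (spec q t v)).coeff (j + 1) *
            ((quot q t A v w).coeff (k - j) * q ^ (k - j)) -
            ∑ j ∈ Finset.range (k + 1), (epoly (spec q t w)).coeff (j + 1) *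
            (quot q t A v w).coeff (k - j) := by
        rw [← Finset.sum_sub_distrib]
        refine Finset.sum_congr rfl fun j _ => ?_
        rw [map_mul, map_sub, eval_C, eval_coeff_epolyMv, hp2 _ (by omega)]
        ring
      rw [h3]
      linear_combination -h

/-- The finite set of compositions of weight at most `D`. -/
def comps (n D : ℕ) : Finset (Fin n → ℕ) :=
  (Fintype.piFinset fun _ => Finset.range (D + 1)).filter fun u => wt u ≤ D

@[simp] theorem mem_comps {D : ℕ} {u : Fin n → ℕ} : u ∈ comps n D ↔ wt u ≤ D := by
  simp only [comps, Finset.mem_filter, Fintype.mem_piFinset, Finset.mem_range]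
  exact ⟨fun h => h.2, fun h => ⟨fun i => Nat.lt_succ_of_le ((le_wt u i).trans h), h⟩⟩

theorem IsNormalized.coeff_quot_eq_sum {q t : ℂ} (hg : Generic q t)
    {A : (Fin n → ℕ) → MvPolynomial (Fin n) ℂ} (hA : IsNormalized q t A) (v w : Fin n → ℕ)
    {k D : ℕ} (hD : wt v + k ≤ D) :
    (quot q t A v w).coeff k = ∑ u ∈ (comps n D).filter fun u => wt u = wt v + k,
      eval (spec q t u) (A v) / mval q t v * eval (spec q t w) (A u) := by
  obtain ⟨p, hp1, hp2⟩ := hA.exists_poly_coeff_quot hg v k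
  have hp : p = ∑ u ∈ (comps n D).filter fun u => wt u = wt v + k,
      C (eval (spec q t u) (A v) / mval q t v) * A u := by
    refine eq_of_eval_spec_eq hg hp1 (totalDegree_finsetSum_le fun u hu => ?_) fun w hw => ?_
    · rw [Finset.mem_filter] at hu
      exact (totalDegree_C_mul_le _ _).trans ((hA.deg_le u).trans hu.2.le)
    · rw [hp2, map_sum]
      rcases hw.lt_or_eq with h | h
      · rw [hA.coeff_quot_eq_zero hg v w h]
        refine (Finset.sum_eq_zero fun u hu => ?_).symm
        rw [Finset.mem_filter] at hu
        rw [map_mul, hA.vanish u w (by omega) (by rintro rfl; omega), mul_zero]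
      · rw [Finset.sum_eq_single w]
        · rw [map_mul, eval_C, hA.diag]
          have := hA.coeff_quot_top hg v w h
          have hm := mval_ne_zero hg v
          field_simp
          linear_combination this
        · intro u hu hne
          rw [Finset.mem_filter] at hu
          rw [map_mul, hA.vanish u w (by omega) hne.symm, mul_zero]
        · intro hu
          exact absurd (Finset.mem_filter.2 ⟨mem_comps.2 (by omega), h⟩) hu
  rw [← hp2, hp, map_sum]
  simp only [map_mul, eval_C]

theorem IsNormalized.sum_pow_mul {q t : ℂ} (hg : Generic q t)
    {A : (Fin n → ℕ) → MvPolynomial (Fin n) ℂ} (hA : IsNormalized q t A) (v w : Fin n → ℕ)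
    {D : ℕ} (hD : wt w ≤ D) (a : ℂ) :
    cfac q t a v * ∑ u ∈ comps n D, a ^ (wt u - wt v) *
      (eval (spec q t u) (A v) / mval q t v) * eval (spec q t w) (A u) =
      eval (spec q t w) (A v) * cfac q t a w := by
  have hq : quot q t A v w = ∑ u ∈ comps n D, Polynomial.monomial (wt u - wt v)
      (eval (spec q t u) (A v) / mval q t v * eval (spec q t w) (A u)) := by
    ext k
    rw [Polynomial.finsetSum_coeff]
    simp only [Polynomial.coeff_monomial]
    have hz : ∀ u, wt u < wt v → eval (spec q t u) (A v) = 0 := fun u hu =>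
      hA.vanish v u hu.le (by rintro rfl; omega)
    rcases le_or_gt (wt v + k) D with h | h
    · rw [hA.coeff_quot_eq_sum hg v w h, Finset.sum_filter]
      refine Finset.sum_congr rfl fun u _ => ?_
      rcases lt_or_ge (wt u) (wt v) with h1 | h1
      · rw [hz u h1]; simp
      · have : wt u = wt v + k ↔ wt u - wt v = k := by omega
        simp only [this]
    · rw [hA.coeff_quot_eq_zero hg v w (by omega)]
      refine (Finset.sum_eq_zero fun u hu => ?_).symm
      rw [mem_comps] at hu
      split_ifs with hk
      · rw [hz u (by omega)]; simp
      · rfl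
  have h := congrArg (Polynomial.eval a) (hA.cpoly_mul_quot hg v w)
  rw [Polynomial.eval_mul, Polynomial.eval_mul, Polynomial.eval_C, eval_cpoly, eval_cpoly, hq,
    Polynomial.eval_finsetSum] at h
  rw [← h]
  congr 1
  refine Finset.sum_congr rfl fun u _ => ?_
  rw [Polynomial.eval_monomial]
  ring

/-- The noncommutative algebra behind the Heine transformation: `δ` embeds a commutative ring of
diagonal matrices. -/
theorem heine_ring_identity {R K : Type*} [Ring R] [CommRing K] (δ : K →+* R)
    {N Va Vc Vb Vg Va' Vc' : R} {pa pc pc' m ea eb ec eg ea' ec' : K}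
    (hpc : pc * pc' = 1) (hea : ea * ea' = 1) (hec : ec * ec' = 1)
    (hVa : Va * Va' = 1) (hVa2 : Va' * Va = 1) (hVc : Vc * Vc' = 1) (hVc2 : Vc' * Vc = 1)
    (ha : N * Va * δ ea = δ ea * N) (hb : N * Vb * δ eb = δ eb * N)
    (hc : N * Vc * δ ec = δ ec * N) (hg : N * Vg * δ eg = δ eg * N)
    (hma : δ (pa * m) * N = Va * δ (pa * m)) (hmc : δ (pc * m) * N = Vc * δ (pc * m))
    (hbg : δ pa * Vb * δ pc = δ pc * Vg * δ pa) (hca : δ pa * Vc * δ pc = δ pc * Va * δ pa) :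
    N * δ (pa * m * eb * ec') * N * δ (pc * eg) =
      δ (ea * ec') * N * δ (pc * m * eg * ea') * N * δ (pa * eb) := by
  have cancel : ∀ {k k' : K} {V V' : R}, k * k' = 1 → V * V' = 1 → N * V * δ k = δ k * N →
      δ k' * N = N * δ k' * V' := by
    intro k k' V V' hk hV h
    have hk' : k' * k = 1 := by rw [mul_comm, hk]
    have h1 : δ k' * (N * V * δ k) * δ k' * V' = δ k' * (δ k * N) * δ k' * V' := by rw [h]
    calc δ k' * N = δ k' * N * (V * δ (k * k') * V') := by rw [hk, map_one, mul_one, hV, mul_one]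
      _ = δ k' * (N * V * δ k) * δ k' * V' := by rw [map_mul]; noncomm_ring
      _ = δ k' * (δ k * N) * δ k' * V' := h1
      _ = δ (k' * k) * N * δ k' * V' := by rw [map_mul]; noncomm_ring
      _ = N * δ k' * V' := by rw [hk', map_one, one_mul]
  have hc' := cancel hec hVc hc
  have ha' := cancel hea hVa ha
  have hc'' : δ ec' * N * Vc = N * δ ec' := by rw [hc', mul_assoc, hVc2, mul_one]
  have key : δ pa * Vc' * Vb * δ pc = δ pc * Va' * Vg * δ pa := by
    have h1 : δ pa * Vc' = δ pc * Va' * δ (pa * pc') := by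
      symm
      calc δ pc * Va' * δ (pa * pc')
          = δ pc * Va' * δ pc' * δ pa * (Vc * δ (pc * pc') * Vc') := by
            rw [hpc, map_one, mul_one, hVc, mul_one, mul_comm pa, map_mul]; noncomm_ring
        _ = δ pc * Va' * δ pc' * (δ pa * Vc * δ pc) * δ pc' * Vc' := by
            rw [map_mul]; noncomm_ring
        _ = δ pc * Va' * δ (pc' * pc) * Va * δ pa * δ pc' * Vc' := by
            rw [hca, map_mul]; noncomm_ring
        _ = δ pc * (Va' * Va) * δ pa * δ pc' * Vc' := by
            rw [mul_comm pc', hpc, map_one, mul_one]; noncomm_ring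
        _ = δ (pc * pc') * δ pa * Vc' := by
            rw [hVa2, mul_one, ← map_mul, ← map_mul, ← map_mul]; congr 2; ring
        _ = δ pa * Vc' := by rw [hpc, map_one, one_mul]
    calc δ pa * Vc' * Vb * δ pc = δ pc * Va' * δ pc' * (δ pa * Vb * δ pc) := by
          rw [h1, mul_comm pa, map_mul]; noncomm_ring
      _ = δ pc * Va' * δ (pc' * pc) * Vg * δ pa := by rw [hbg, map_mul]; noncomm_ring
      _ = δ pc * Va' * Vg * δ pa := by rw [mul_comm pc', hpc, map_one, mul_one]
  calc N * δ (pa * m * eb * ec') * N * δ (pc * eg)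
      = N * δ (pa * m) * δ ec' * (δ eb * N) * δ (pc * eg) := by
        rw [show pa * m * eb * ec' = (pa * m) * ec' * eb by ring]
        simp only [map_mul]; noncomm_ring
    _ = N * δ (pa * m) * (δ ec' * N) * Vb * δ eb * δ (pc * eg) := by
        rw [← hb]; noncomm_ring
    _ = N * (δ (pa * m) * N) * δ ec' * Vc' * Vb * δ eb * δ (pc * eg) := by
        rw [hc']; noncomm_ring
    _ = N * Va * δ ((pa * m) * ec') * Vc' * Vb * δ (eb * (pc * eg)) := by
        rw [hma, map_mul _ (pa * m), map_mul _ eb]; noncomm_ring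
    _ = N * Va * δ (m * ec') * (δ pa * Vc' * Vb * δ pc) * δ (eb * eg) := by
        rw [show pa * m * ec' = m * ec' * pa by ring, show eb * (pc * eg) = pc * (eb * eg) by ring,
          map_mul _ _ pa, map_mul _ pc]
        noncomm_ring
    _ = N * Va * δ (m * ec') * (δ pc * Va' * Vg * δ pa) * δ (eb * eg) := by rw [key]
    _ = N * Va * δ (m * ec' * pc * (ea * ea')) * Va' * Vg * δ (eg * (pa * eb)) := by
        rw [hea, mul_one, show eg * (pa * eb) = pa * (eb * eg) by ring, map_mul _ _ pc,
          map_mul _ pa]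
        noncomm_ring
    _ = (N * Va * δ ea) * δ ec' * δ (pc * m) * δ ea' * Va' * Vg * δ (eg * (pa * eb)) := by
        rw [show m * ec' * pc * (ea * ea') = ea * ec' * (pc * m) * ea' by ring]
        simp only [map_mul]; noncomm_ring
    _ = δ ea * (N * δ ec') * δ (pc * m) * δ ea' * Va' * Vg * δ (eg * (pa * eb)) := by
        rw [ha]; noncomm_ring
    _ = δ (ea * ec') * N * (Vc * δ (pc * m)) * δ ea' * Va' * Vg * δ (eg * (pa * eb)) := by
        rw [← hc'', map_mul _ ea ec']; noncomm_ring
    _ = δ (ea * ec') * N * δ (pc * m) * (N * δ ea' * Va') * Vg * δ (eg * (pa * eb)) := by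
        rw [← hmc]; noncomm_ring
    _ = δ (ea * ec') * N * δ (pc * m) * δ ea' * (N * Vg * δ eg) * δ (pa * eb) := by
        rw [← ha', map_mul _ eg]; noncomm_ring
    _ = δ (ea * ec') * N * δ (pc * m * eg * ea') * N * δ (pa * eb) := by
        rw [hg, show pc * m * eg * ea' = pc * m * ea' * eg by ring, map_mul _ (pc * m * ea'),
          map_mul _ (pc * m)]
        noncomm_ring

/-- The matrix of the values `A_u(⟨w⟩)` divided by the diagonal entries. -/
def nmat (q t : ℂ) (A : (Fin n → ℕ) → MvPolynomial (Fin n) ℂ) (D : ℕ) :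
    Matrix (comps n D) (comps n D) ℂ :=
  Matrix.of fun w u => eval (spec q t w.1) (A u.1) / mval q t u.1

/-- The conjugate of `nmat` with entries weighted by powers of `s`. -/
def vmat (q t : ℂ) (A : (Fin n → ℕ) → MvPolynomial (Fin n) ℂ) (D : ℕ) (s : ℂ) :
    Matrix (comps n D) (comps n D) ℂ :=
  Matrix.of fun w u => s ^ (wt w.1 - wt u.1) * mval q t w.1 * nmat q t A D w u / mval q t u.1

theorem IsNormalized.wt_le_of_nmat_ne_zero {q t : ℂ}
    {A : (Fin n → ℕ) → MvPolynomial (Fin n) ℂ} (hA : IsNormalized q t A) {D : ℕ}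
    {w u : comps n D} (h : nmat q t A D w u ≠ 0) : wt u.1 ≤ wt w.1 := by
  by_contra! hlt
  exact h (by rw [nmat, Matrix.of_apply, hA.vanish _ _ hlt.le (by rintro h; simp [h] at hlt),
    zero_div])

theorem IsNormalized.isUnit_nmat {q t : ℂ} (hg : Generic q t)
    {A : (Fin n → ℕ) → MvPolynomial (Fin n) ℂ} (hA : IsNormalized q t A) (D : ℕ) :
    IsUnit (nmat q t A D) := by
  rw [← Matrix.mulVec_injective_iff_isUnit]
  refine (injective_iff_map_eq_zero (Matrix.mulVecLin (nmat q t A D)).toAddMonoidHom).2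
    fun x hx => ?_
  have hx' : (nmat q t A D).mulVec x = 0 := hx
  have key : ∀ d, ∀ w : comps n D, wt w.1 = d → x w = 0 := by
    intro d
    induction d using Nat.strong_induction_on with
    | _ d ih =>
      intro w hw
      have h1 := congrFun hx' w
      rw [Matrix.mulVec, dotProduct, Finset.sum_eq_single w] at h1
      · rw [nmat, Matrix.of_apply, hA.diag, div_self (mval_ne_zero hg _), one_mul] at h1
        exact h1
      · intro u _ huw
        rcases lt_or_ge (wt u.1) d with h | h
        · rw [ih _ h u rfl, mul_zero]
        · rw [nmat, Matrix.of_apply, hA.vanish _ _ (hw ▸ h) (fun h => huw (Subtype.ext h.symm)),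
            zero_div, zero_mul]
      · simp
  exact funext fun w => key _ w rfl

theorem IsNormalized.nmat_mul_vmat {q t : ℂ} (hg : Generic q t)
    {A : (Fin n → ℕ) → MvPolynomial (Fin n) ℂ} (hA : IsNormalized q t A) (D : ℕ) (s : ℂ) :
    nmat q t A D * vmat q t A D s * Matrix.diagonalRingHom _ ℂ (fun u => cfac q t s u.1) =
      Matrix.diagonalRingHom _ ℂ (fun u => cfac q t s u.1) * nmat q t A D := by
  ext w v
  have h := hA.sum_pow_mul hg v.1 w.1 (mem_comps.1 w.2) s
  have hm := mval_ne_zero hg v.1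
  rw [Matrix.diagonalRingHom_apply, Matrix.mul_diagonal, Matrix.diagonal_mul, Matrix.mul_apply,
    ← Finset.sum_coe_sort (comps n D)] at *
  rw [nmat, Matrix.of_apply, mul_div_assoc', mul_comm (cfac q t s w.1), ← h, mul_comm,
    mul_div_assoc, Finset.sum_div]
  congr 1
  refine Finset.sum_congr rfl fun u _ => ?_
  have hu := mval_ne_zero hg u.1
  simp only [nmat, vmat, Matrix.of_apply]
  field_simp

theorem IsNormalized.diagonal_mul_nmat {q t : ℂ} (hg : Generic q t)
    {A : (Fin n → ℕ) → MvPolynomial (Fin n) ℂ} (hA : IsNormalized q t A) (D : ℕ) (s : ℂ) :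
    Matrix.diagonalRingHom _ ℂ ((fun u : comps n D => s ^ wt u.1) * fun u => mval q t u.1) *
        nmat q t A D =
      vmat q t A D s *
        Matrix.diagonalRingHom _ ℂ ((fun u => s ^ wt u.1) * fun u => mval q t u.1) := by
  ext w v
  have hm := mval_ne_zero hg v.1
  rw [Matrix.diagonalRingHom_apply, Matrix.mul_diagonal, Matrix.diagonal_mul, vmat,
    Matrix.of_apply]
  by_cases h : nmat q t A D w v = 0
  · simp [h]
  have hw := hA.wt_le_of_nmat_ne_zero h
  simp only [Pi.mul_apply]
  rw [show s ^ wt w.1 = s ^ (wt w.1 - wt v.1) * s ^ wt v.1 by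
    rw [← pow_add, Nat.sub_add_cancel hw]]
  field_simp

theorem IsNormalized.diagonal_mul_vmat_mul_diagonal {q t : ℂ}
    {A : (Fin n → ℕ) → MvPolynomial (Fin n) ℂ} (hA : IsNormalized q t A) (D : ℕ)
    {a b c g : ℂ} (h : a * b = c * g) :
    Matrix.diagonalRingHom _ ℂ (fun u : comps n D => a ^ wt u.1) * vmat q t A D b *
        Matrix.diagonalRingHom _ ℂ (fun u : comps n D => c ^ wt u.1) =
      Matrix.diagonalRingHom _ ℂ (fun u : comps n D => c ^ wt u.1) * vmat q t A D g *
        Matrix.diagonalRingHom _ ℂ (fun u : comps n D => a ^ wt u.1) := by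
  ext w v
  simp only [Matrix.diagonalRingHom_apply, Matrix.mul_diagonal, Matrix.diagonal_mul, vmat,
    Matrix.of_apply]
  by_cases h0 : nmat q t A D w v = 0
  · simp [h0]
  have hw := hA.wt_le_of_nmat_ne_zero h0
  obtain ⟨k, hk⟩ := Nat.exists_eq_add_of_le hw
  rw [hk, Nat.add_sub_cancel_left, pow_add, pow_add]
  have h2 : a ^ k * b ^ k = c ^ k * g ^ k := by rw [← mul_pow, h, mul_pow]
  linear_combination (a ^ wt v.1 * c ^ wt v.1 * mval q t w.1 * nmat q t A D w v / mval q t v.1) * h2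

theorem IsNormalized.exists_inv_vmat {q t : ℂ} (hg : Generic q t)
    {A : (Fin n → ℕ) → MvPolynomial (Fin n) ℂ} (hA : IsNormalized q t A) (D : ℕ) {s : ℂ}
    (hs : ∀ u : Fin n → ℕ, cfac q t s u ≠ 0) :
    ∃ V, vmat q t A D s * V = 1 ∧ V * vmat q t A D s = 1 := by
  have h := congrArg Matrix.det (hA.nmat_mul_vmat hg D s)
  have hd : ∏ u : comps n D, cfac q t s u.1 ≠ 0 := Finset.prod_ne_zero_iff.2 fun u _ => hs u.1
  have hN := (Matrix.isUnit_iff_isUnit_det _).1 (hA.isUnit_nmat hg D)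
  rw [Matrix.diagonalRingHom_apply, Matrix.det_mul, Matrix.det_mul, Matrix.det_mul,
    Matrix.det_diagonal, mul_comm] at h
  have h1 : IsUnit (vmat q t A D s) := by
    rw [Matrix.isUnit_iff_isUnit_det, isUnit_iff_ne_zero]
    intro h0
    rw [h0, mul_zero, mul_zero] at h
    exact mul_ne_zero hd hN.ne_zero h.symm
  exact ⟨(h1.unit⁻¹ : _), h1.mul_val_inv, h1.val_inv_mul⟩

theorem mul_diagonal_mul_mul_diagonal_apply {ι : Type*} [Fintype ι] [DecidableEq ι]
    (N : Matrix ι ι ℂ) (d e : ι → ℂ) (w v : ι) :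
    (N * Matrix.diagonalRingHom ι ℂ d * N * Matrix.diagonalRingHom ι ℂ e) w v =
      (∑ u, N w u * d u * N u v) * e v := by
  rw [Matrix.diagonalRingHom_apply, Matrix.diagonalRingHom_apply, Matrix.mul_diagonal,
    Matrix.mul_apply]
  simp only [Matrix.mul_diagonal]

theorem diagonal_mul_mul_diagonal_mul_mul_diagonal_apply {ι : Type*} [Fintype ι] [DecidableEq ι]
    (N : Matrix ι ι ℂ) (f d e : ι → ℂ) (w v : ι) :
    (Matrix.diagonalRingHom ι ℂ f * N * Matrix.diagonalRingHom ι ℂ d * N *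
      Matrix.diagonalRingHom ι ℂ e) w v = f w * ((∑ u, N w u * d u * N u v) * e v) := by
  rw [← mul_diagonal_mul_mul_diagonal_apply, ← Matrix.diagonal_mul,
    Matrix.diagonalRingHom_apply _ _ f]
  simp only [mul_assoc]

/-- The Heine transformation at a spectral vector, where both sums are finite. -/
theorem IsNormalized.heine_spec {q t : ℂ} (hg : Generic q t)
    {A : (Fin n → ℕ) → MvPolynomial (Fin n) ℂ} (hA : IsNormalized q t A) {D : ℕ}
    {v w : Fin n → ℕ} (hv : wt v ≤ D) (hw : wt w ≤ D) {a b c g : ℂ} (hc0 : c ≠ 0)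
    (ha : ∀ u : Fin n → ℕ, cfac q t a u ≠ 0) (hc : ∀ u : Fin n → ℕ, cfac q t c u ≠ 0)
    (h : a * b = c * g) :
    (∑ u ∈ comps n D, a ^ wt u * (cfac q t b u / cfac q t c u) *
        (eval (spec q t u) (A v) / mval q t v) * eval (spec q t w) (A u)) *
        (c ^ wt v * cfac q t g v) =
      cfac q t a w / cfac q t c w * (a ^ wt v * cfac q t b v) *
        ∑ u ∈ comps n D, c ^ wt u * (cfac q t g u / cfac q t a u) *
          (eval (spec q t u) (A v) / mval q t v) * eval (spec q t w) (A u) := by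
  obtain ⟨Va', hVa, hVa2⟩ := hA.exists_inv_vmat hg D ha
  obtain ⟨Vc', hVc, hVc2⟩ := hA.exists_inv_vmat hg D hc
  have hid := heine_ring_identity (Matrix.diagonalRingHom (comps n D) ℂ)
    (pa := fun u => a ^ wt u.1) (pc := fun u => c ^ wt u.1) (pc' := fun u => (c ^ wt u.1)⁻¹)
    (m := fun u => mval q t u.1) (ea' := fun u => (cfac q t a u.1)⁻¹)
    (ec' := fun u => (cfac q t c u.1)⁻¹)
    (funext fun u => mul_inv_cancel₀ (pow_ne_zero _ hc0))
    (funext fun u => mul_inv_cancel₀ (ha u.1)) (funext fun u => mul_inv_cancel₀ (hc u.1))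
    hVa hVa2 hVc hVc2 (hA.nmat_mul_vmat hg D a) (hA.nmat_mul_vmat hg D b)
    (hA.nmat_mul_vmat hg D c) (hA.nmat_mul_vmat hg D g) (hA.diagonal_mul_nmat hg D a)
    (hA.diagonal_mul_nmat hg D c) (hA.diagonal_mul_vmat_mul_diagonal D h)
    (hA.diagonal_mul_vmat_mul_diagonal D (mul_comm a c))
  have hent := congrFun (congrFun hid ⟨w, mem_comps.2 hw⟩) ⟨v, mem_comps.2 hv⟩
  rw [mul_diagonal_mul_mul_diagonal_apply,
    diagonal_mul_mul_diagonal_mul_mul_diagonal_apply] at hent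
  simp only [Pi.mul_apply] at hent
  rw [← Finset.sum_coe_sort (comps n D), ← Finset.sum_coe_sort (comps n D)]
  have hm := fun u : Fin n → ℕ => mval_ne_zero hg u
  convert hent using 1
  · rw [Finset.sum_mul, Finset.sum_mul]
    refine Finset.sum_congr rfl fun u _ => ?_
    have := hm u.1
    have := hm v
    simp only [nmat, Matrix.of_apply]
    field_simp
  · rw [Finset.mul_sum, Finset.sum_mul, Finset.mul_sum]
    refine Finset.sum_congr rfl fun u _ => ?_
    have := hm u.1
    have := hm v
    have := hc w
    simp only [nmat, Matrix.of_apply]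
    field_simp

/-- `∑ i, (u i - ⌊(c + i) / (m + 1)⌋)`, with truncated subtraction. -/
def ccnt {m : ℕ} (u : Fin (m + 1) → ℕ) (c : ℕ) : ℕ := ∑ i, (u i - (c + i) / (m + 1))

theorem ccnt_phi {m : ℕ} (u : Fin (m + 1) → ℕ) (c : ℕ) : ccnt (phi u) (c + 1) = ccnt u c := by
  rw [ccnt, ccnt, Fin.sum_univ_castSucc, Fin.sum_univ_succ, add_comm]
  congr 1
  · have h : (c + 1 + m) / (m + 1) = c / (m + 1) + 1 := by
      rw [show c + 1 + m = c + (m + 1) by ring, Nat.add_div_right _ (Nat.succ_pos m)]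
    simp [h]
  · refine Finset.sum_congr rfl fun i _ => ?_
    rw [phi_castSucc, Fin.val_castSucc, Fin.val_succ, add_assoc, add_comm 1]

theorem ccnt_zero {m : ℕ} (u : Fin (m + 1) → ℕ) : ccnt u 0 = wt u :=
  Finset.sum_congr rfl fun i _ => by rw [zero_add, Nat.div_eq_of_lt i.2, Nat.sub_zero]

theorem sum_choose_two (a : ℕ) : ∀ M, a ≤ M → ∑ c ∈ Finset.range M, (a - (c + 1)) = a.choose 2 := by
  intro M h
  obtain ⟨d, rfl⟩ := Nat.exists_eq_add_of_le h
  clear h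
  have h0 : ∑ c ∈ Finset.range d, (a - (a + c + 1)) = 0 :=
    Finset.sum_eq_zero fun c _ => by omega
  rw [Finset.sum_range_add, h0, add_zero, ← Finset.sum_range_reflect, Nat.choose_two_right,
    ← Finset.sum_range_id_mul_two, Nat.mul_div_cancel _ two_pos]
  refine Finset.sum_congr rfl fun c hc => ?_
  have := Finset.mem_range.1 hc
  omega

theorem nstat'_eq_sum_ccnt {m : ℕ} (u : Fin (m + 1) → ℕ) {M : ℕ} (h : wt u ≤ M) :
    nstat' u = ∑ c ∈ Finset.range M, ccnt u ((m + 1) * (c + 1)) := by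
  simp only [nstat', ccnt]
  rw [Finset.sum_comm]
  refine Finset.sum_congr rfl fun i _ => ?_
  rw [← sum_choose_two _ M ((le_wt u i).trans h)]
  refine Finset.sum_congr rfl fun c _ => ?_
  rw [Nat.mul_add_div (Nat.succ_pos m), Nat.div_eq_of_lt i.2, add_zero]

/-- A partial order on compositions of a given weight, refining the dominance order. -/
structure Below {m : ℕ} (κ u : Fin (m + 1) → ℕ) : Prop where
  wt_eq : wt κ = wt u
  ccnt_le : ∀ c, ccnt κ c ≤ ccnt u c

theorem Below.phi {m : ℕ} {κ u : Fin (m + 1) → ℕ} (h : Below κ u) : Below (phi κ) (phi u) := by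
  have hw : wt (LRW.phi κ) = wt (LRW.phi u) := by rw [wt_phi, wt_phi, h.wt_eq]
  refine ⟨hw, fun c => ?_⟩
  cases c with
  | zero => rw [ccnt_zero, ccnt_zero, hw]
  | succ c => rw [ccnt_phi, ccnt_phi]; exact h.ccnt_le c

theorem Below.nstat'_le {m : ℕ} {κ u : Fin (m + 1) → ℕ} (h : Below κ u) :
    nstat' κ ≤ nstat' u := by
  rw [nstat'_eq_sum_ccnt u le_rfl, nstat'_eq_sum_ccnt κ h.wt_eq.le]
  exact Finset.sum_le_sum fun c _ => h.ccnt_le _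

theorem sum_eq_adj_add {m : ℕ} (k : Fin m) (f : Fin (m + 1) → ℕ) :
    ∑ i, f i = ∑ i ∈ (Finset.univ.erase k.castSucc).erase k.succ, f i +
      f k.castSucc + f k.succ := by
  have h : k.succ ∈ Finset.univ.erase k.castSucc := by
    simp [Fin.ext_iff]
  rw [← Finset.sum_erase_add _ _ (Finset.mem_univ k.castSucc), ← Finset.sum_erase_add _ _ h]
  ring

theorem add_div_succ_eq {m c i k : ℕ} (hm : i < m + 1) (hi : i ≠ k) (hk : (m + 1) ∣ (c + 1 + k))
    (hkm : k < m + 1) : (c + 1 + i) / (m + 1) = (c + i) / (m + 1) := by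
  rw [show c + 1 + i = c + i + 1 by ring, Nat.succ_div, if_neg, add_zero]
  intro h
  apply hi
  have h1 : c + 1 + i ≡ c + 1 + k [MOD m + 1] := by
    rw [Nat.ModEq, Nat.mod_eq_zero_of_dvd hk, show c + 1 + i = c + i + 1 by ring,
      Nat.mod_eq_zero_of_dvd h]
  exact (Nat.ModEq.add_left_cancel' _ h1).eq_of_lt_of_lt hm hkm

theorem Below.adj {m : ℕ} {κ u : Fin (m + 1) → ℕ} (h : Below κ u) (k : Fin m)
    (hk : u k.castSucc < u k.succ) :
    Below κ (u ∘ adj k) ∧ Below (κ ∘ adj k) (u ∘ adj k) := by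
  have key : ∀ c, ccnt κ c ≤ ccnt (u ∘ LRW.adj k) c ∧
      ccnt (κ ∘ LRW.adj k) c ≤ ccnt (u ∘ LRW.adj k) c := by
    intro c
    set s := (Finset.univ.erase k.castSucc).erase k.succ with hs
    have hrest : ∀ (v : Fin (m + 1) → ℕ) (c : ℕ), ∑ i ∈ s, ((v ∘ LRW.adj k) i -
        (c + i) / (m + 1)) = ∑ i ∈ s, (v i - (c + i) / (m + 1)) := by
      intro v c
      refine Finset.sum_congr rfl fun i hi => ?_
      simp only [hs, Finset.mem_erase] at hi
      rw [Function.comp, LRW.adj, Equiv.swap_apply_of_ne_of_ne hi.2.1 hi.1]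
    have hc := h.ccnt_le c
    by_cases hd : (m + 1) ∣ (c + k + 1)
    · obtain ⟨e, he⟩ := hd
      have hkm := k.2
      obtain ⟨c, rfl⟩ : ∃ d, c = d + 1 := by
        refine Nat.exists_eq_succ_of_ne_zero ?_
        rintro rfl
        rcases e with _ | e
        · omega
        · have : m + 1 ≤ (m + 1) * (e + 1) := Nat.le_mul_of_pos_right _ (Nat.succ_pos e)
          omega
      obtain ⟨e, rfl⟩ : ∃ d, e = d + 1 := by
        refine Nat.exists_eq_succ_of_ne_zero ?_
        rintro rfl
        omega
      have d0 : (c + (k + 1)) / (m + 1) = e := by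
        rw [show c + (k + 1) = m + (m + 1) * e by linarith,
          Nat.add_mul_div_left _ _ (Nat.succ_pos m),
          Nat.div_eq_of_lt (Nat.lt_succ_self m), zero_add]
      have d1 : (c + 1 + (k + 1)) / (m + 1) = e + 1 := by
        rw [show c + 1 + (k + 1) = (m + 1) * (e + 1) by linarith,
          Nat.mul_div_cancel_left _ (Nat.succ_pos m)]
      have d3 : (c + k) / (m + 1) = e := by
        rw [← add_div_succ_eq (k := (k : ℕ) + 1) (by omega) (by omega) ⟨e + 1, by linarith⟩
          (by omega), show c + 1 + k = c + (k + 1) by ring, d0]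
      have d2 : (c + 1 + 1 + (k + 1)) / (m + 1) = e + 1 := by
        rw [add_div_succ_eq (k := (k : ℕ)) (by omega) (by omega) ⟨e + 1, by linarith⟩ (by omega),
          d1]
      have r0 : ∀ v : Fin (m + 1) → ℕ, ∑ i ∈ s, (v i - (c + i) / (m + 1)) =
          ∑ i ∈ s, (v i - (c + 1 + i) / (m + 1)) := by
        intro v
        refine Finset.sum_congr rfl fun i hi => ?_
        simp only [hs, Finset.mem_erase] at hi
        rw [add_div_succ_eq (k := (k : ℕ) + 1) i.2 (fun h => hi.1 (Fin.ext h))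
          ⟨e + 1, by linarith⟩ (by omega)]
      have r1 : ∀ v : Fin (m + 1) → ℕ, ∑ i ∈ s, (v i - (c + 1 + 1 + i) / (m + 1)) =
          ∑ i ∈ s, (v i - (c + 1 + i) / (m + 1)) := by
        intro v
        refine Finset.sum_congr rfl fun i hi => ?_
        simp only [hs, Finset.mem_erase] at hi
        rw [add_div_succ_eq (k := (k : ℕ)) i.2 (fun h => hi.2.1 (Fin.ext h))
          ⟨e + 1, by linarith⟩ (by omega)]
      have hc0 := h.ccnt_le c
      have hc1 := h.ccnt_le (c + 1 + 1)
      simp only [ccnt] at hc hc0 hc1 ⊢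
      simp only [sum_eq_adj_add k, ← hs, hrest] at hc hc0 hc1 ⊢
      rw [r0, r0] at hc0
      rw [r1, r1] at hc1
      simp only [Fin.val_castSucc, Fin.val_succ, Function.comp, adj_castSucc, adj_succ, d0, d1, d2,
        show c + 1 + (k : ℕ) = c + (k + 1) by ring,
        show c + 1 + 1 + (k : ℕ) = c + 1 + (k + 1) by ring, d3] at hc hc0 hc1 ⊢
      constructor <;> omega
    · have hswap : ∀ v : Fin (m + 1) → ℕ, ccnt (v ∘ LRW.adj k) c = ccnt v c := by
        intro v
        have hdiv : (c + (k + 1)) / (m + 1) = (c + k) / (m + 1) := by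
          rw [← add_assoc, Nat.succ_div, if_neg hd, add_zero]
        rw [ccnt, ccnt, sum_eq_adj_add k, sum_eq_adj_add k, ← hs, hrest]
        simp only [Fin.val_castSucc, Fin.val_succ, Function.comp, adj_castSucc, adj_succ, hdiv]
        ring
      rw [hswap, hswap]
      exact ⟨hc, hc⟩
  exact ⟨⟨by rw [wt_comp, h.wt_eq], fun c => (key c).1⟩,
    ⟨by rw [wt_comp, wt_comp, h.wt_eq], fun c => (key c).2⟩⟩

theorem mval_comp_adj {m : ℕ} (q t : ℂ) (u : Fin (m + 1) → ℕ) (k : Fin m)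
    (h : u k.castSucc ≠ u k.succ) : mval q t (u ∘ adj k) = mval q t u := by
  rw [mval, mval, ← Equiv.prod_comp (adj k)]
  simp only [lp_comp_adj u k h, Function.comp, adj_adj]

theorem comp_adj_comp_adj {m : ℕ} {α : Type*} (u : Fin (m + 1) → α) (k : Fin m) :
    (u ∘ adj k) ∘ adj k = u := by
  ext i
  simp

/-- The Hecke recursion for the interpolation polynomials. -/
theorem IsNormalized.hecke {m : ℕ} {q t : ℂ} (hg : Generic q t)
    {A : (Fin (m + 1) → ℕ) → MvPolynomial (Fin (m + 1)) ℂ} (hA : IsNormalized q t A)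
    (u : Fin (m + 1) → ℕ) (k : Fin m) (hk : u k.castSucc ≠ u k.succ)
    (z : Fin (m + 1) → ℂ) (hz : z k.castSucc - z k.succ ≠ 0) :
    (spec q t u k.succ - t * spec q t u k.castSucc) * eval z (A (u ∘ adj k)) =
      (spec q t u k.succ - spec q t u k.castSucc) *
        ((t - 1) * z k.castSucc / (z k.castSucc - z k.succ) * eval z (A u) +
          (z k.castSucc - t * z k.succ) / (z k.castSucc - z k.succ) *
            eval (z ∘ adj k) (A u)) +
        (t - 1) * spec q t u k.castSucc * eval z (A u) := by
  obtain ⟨g, h1, h2, -⟩ := exists_hecke t k (A u)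
  set x := spec q t u k.castSucc with hx
  set y := spec q t u k.succ with hy
  have hw : wt (u ∘ adj k) = wt u := wt_comp _ _
  have hne : u ∘ adj k ≠ u := by
    intro h
    have := congrFun h k.castSucc
    simp only [Function.comp, adj_castSucc] at this
    exact hk this.symm
  have hpoly : C (y - t * x) * A (u ∘ adj k) = C (y - x) * g + C ((t - 1) * x) * A u := by
    refine eq_of_eval_spec_eq hg (d := wt u) ?_ ?_ fun v hv => ?_
    · exact (totalDegree_C_mul_le _ _).trans ((hA.deg_le _).trans_eq hw)
    · refine (totalDegree_add _ _).trans (max_le ?_ ?_)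
      · exact (totalDegree_C_mul_le _ _).trans (h1.trans (hA.deg_le u))
      · exact (totalDegree_C_mul_le _ _).trans (hA.deg_le u)
    · simp only [map_add, map_mul, eval_C]
      by_cases hvu : v = u
      · subst hvu
        have h3 := h2 (spec q t v)
        rw [← spec_comp_adj q t v k hk, hA.vanish v _ hw.le hne] at h3
        rw [hA.vanish _ v hw.ge hne.symm]
        linear_combination h3
      by_cases hvs : v = u ∘ adj k
      · subst hvs
        have hk' : (u ∘ adj k) k.castSucc ≠ (u ∘ adj k) k.succ := by simpa using hk.symm
        have h3 := h2 (spec q t (u ∘ adj k))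
        rw [← spec_comp_adj q t _ k hk', comp_adj_comp_adj, hA.vanish u _ hw.le hne,
          spec_comp_adj q t u k hk, hA.diag] at h3
        simp only [Function.comp, adj_castSucc, adj_succ] at h3
        rw [hA.vanish u _ hw.le hne, hA.diag, mval_comp_adj q t u k hk]
        rw [spec_comp_adj q t u k hk]
        linear_combination -h3
      · have h3 := hA.vanish u v hv hvu
        have h4 : eval (spec q t (v ∘ adj k)) (A u) = 0 :=
          hA.vanish u _ ((wt_comp _ _).trans_le hv) fun h => hvs (by
            rw [← h, comp_adj_comp_adj])
        rw [exists_hecke_spec hg k h2 v h3 h4, h3, hA.vanish _ v (hv.trans_eq hw.symm) hvs]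
        simp
  have h3 := congrArg (eval z) hpoly
  simp only [map_add, map_mul, eval_C] at h3
  have h4 := h2 z
  rw [h3]
  field_simp
  linear_combination (y - x) * h4

theorem exists_norm_pow_le (t : ℂ) (N : ℕ) : ∃ T : ℝ, 1 ≤ T ∧ ∀ e ≤ N, ‖t ^ e‖ ≤ T := by
  refine ⟨max 1 ‖t‖ ^ N, one_le_pow₀ (le_max_left _ _), fun e he => ?_⟩
  rw [norm_pow]
  exact (pow_le_pow_left₀ (norm_nonneg _) (le_max_right _ _) e).trans
    (pow_le_pow_right₀ (le_max_left _ _) he)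

theorem exists_norm_inv_le {q t : ℂ} (hg : Generic q t) (N : ℕ) :
    ∃ C : ℝ, ∀ D e f : ℕ, 1 ≤ D → e ≤ N → f ≤ N → ‖(q ^ D * t ^ f - t ^ e)⁻¹‖ ≤ C := by
  have h1 : ∀ e f : ℕ, ∃ B : ℝ, 0 ≤ B ∧ ∀ D : ℕ, ‖(q ^ (D + 1) * t ^ f - t ^ e)⁻¹‖ ≤ B := by
    intro e f
    have hl : Filter.Tendsto (fun D : ℕ => (q ^ (D + 1) * t ^ f - t ^ e)⁻¹) Filter.atTop
        (nhds (0 * t ^ f - t ^ e)⁻¹) := by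
      refine Filter.Tendsto.inv₀ (Filter.Tendsto.sub_const (Filter.Tendsto.mul_const _ ?_) _) ?_
      · exact (Filter.tendsto_add_atTop_iff_nat 1).2
          (tendsto_pow_atTop_nhds_zero_of_norm_lt_one hg.q_lt)
      · simp [hg.t_ne]
    obtain ⟨B, hB⟩ := hl.norm.bddAbove_range
    have hB' : ∀ D : ℕ, ‖(q ^ (D + 1) * t ^ f - t ^ e)⁻¹‖ ≤ B := fun D => hB ⟨D, rfl⟩
    exact ⟨B, (norm_nonneg _).trans (hB' 0), hB'⟩
  choose B hB0 hB using h1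
  refine ⟨∑ e ∈ Finset.range (N + 1), ∑ f ∈ Finset.range (N + 1), B e f,
    fun D e f hD he hf => ?_⟩
  obtain ⟨D, rfl⟩ := Nat.exists_eq_add_of_le' hD
  refine (hB e f D).trans ?_
  refine (Finset.single_le_sum (f := fun f => B e f) (fun f _ => hB0 e f)
    (Finset.mem_range.2 (Nat.lt_succ_of_le hf))).trans ?_
  exact Finset.single_le_sum (f := fun e => ∑ f ∈ Finset.range (N + 1), B e f)
    (fun e _ => Finset.sum_nonneg fun f _ => hB0 e f) (Finset.mem_range.2 (Nat.lt_succ_of_le he))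

/-- The moduli of the entries of `y` are separated by a factor `s`, modulo powers of `ρ`. -/
structure Separated {m : ℕ} (ρ s : ℝ) (y : Fin (m + 1) → ℂ) : Prop where
  sep : ∀ i j, i ≠ j → ∀ e : ℤ, s * ‖y i‖ ≤ ρ ^ e * ‖y j‖ ∨ s * (ρ ^ e * ‖y j‖) ≤ ‖y i‖
  ne_zero : ∀ i, y i ≠ 0

theorem Separated.comp {m : ℕ} {ρ s : ℝ} {y : Fin (m + 1) → ℂ} (h : Separated ρ s y)
    (σ : Equiv.Perm (Fin (m + 1))) : Separated ρ s (y ∘ σ) :=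
  ⟨fun _ _ hij e => h.sep _ _ (fun h => hij (σ.injective h)) e, fun _ => h.ne_zero _⟩

theorem Separated.unrot {m : ℕ} {q : ℂ} {s : ℝ} {y : Fin (m + 1) → ℂ} (hq : q ≠ 0)
    (h : Separated ‖q‖ s y) : Separated ‖q‖ s (unrot q y) := by
  have hq' : 0 < ‖q‖ := norm_pos_iff.2 hq
  refine ⟨fun i j => ?_, fun i => ?_⟩
  · refine Fin.cases ?_ (fun i => ?_) i <;> refine Fin.cases ?_ (fun j => ?_) j
    · simp
    · intro _ e
      have h1 := h.sep (Fin.last m) j.castSucc (Fin.castSucc_lt_last j).ne' (e + 1)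
      rw [zpow_add₀ hq'.ne', zpow_one] at h1
      rw [unrot_zero, unrot_succ, norm_div, ← mul_div_assoc, div_le_iff₀ hq', le_div_iff₀ hq']
      refine h1.imp (fun h => h.trans_eq (by ring)) (fun h => Eq.trans_le (by ring) h)
    · intro _ e
      have h1 := h.sep i.castSucc (Fin.last m) (Fin.castSucc_lt_last i).ne (e - 1)
      rw [zpow_sub₀ hq'.ne', zpow_one] at h1
      rw [unrot_zero, unrot_succ, norm_div]
      refine h1.imp (fun h => h.trans_eq (by ring)) (fun h => Eq.trans_le (by ring) h)
    · intro hij e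
      exact h.sep _ _ (fun h => hij (congrArg Fin.succ (Fin.castSucc_injective _ h))) e
  · refine Fin.cases ?_ (fun i => ?_) i
    · simpa using ⟨h.ne_zero _, hq⟩
    · simpa using h.ne_zero _

theorem Separated.of_norm_eq {m : ℕ} {ρ s R : ℝ} (hs : 1 < s) (hR : 0 < R)
    (hρ : ρ * s ^ (m + 1) = 1) {y : Fin (m + 1) → ℂ} (hy : ∀ i, ‖y i‖ = R * s ^ (i : ℕ)) :
    Separated ρ s y := by
  have hs0 : 0 < s := one_pos.trans hs
  have hρ' : ρ = s ^ (-(m + 1 : ℤ)) := by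
    rw [zpow_neg, ← Nat.cast_succ, zpow_natCast]
    exact eq_inv_of_mul_eq_one_left hρ
  refine ⟨fun i j hij e => ?_, fun i => ?_⟩
  · have h1 : ρ ^ e * ‖y j‖ = R * s ^ (-(m + 1 : ℤ) * e + j) := by
      rw [hρ', hy, ← zpow_mul, zpow_add₀ hs0.ne', zpow_natCast]
      ring
    have h2 : ‖y i‖ = R * s ^ (i : ℤ) := by rw [hy, zpow_natCast]
    have h3 : ∀ a : ℤ, s * (R * s ^ a) = R * s ^ (a + 1) := by
      intro a; rw [zpow_add₀ hs0.ne', zpow_one]; ring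
    have h4 : (i : ℤ) ≠ -(m + 1 : ℤ) * e + j := by
      intro h
      apply hij
      have hd : (i : ℕ) ≡ j [MOD m + 1] := by
        rw [← Int.natCast_modEq_iff]
        refine Int.modEq_iff_dvd.2 ⟨e, ?_⟩
        rw [h]; push_cast; ring
      exact Fin.ext (hd.eq_of_lt_of_lt i.2 j.2)
    rw [h1, h2, h3, h3]
    rcases lt_or_gt_of_ne h4 with h | h
    · left
      exact mul_le_mul_of_nonneg_left (zpow_le_zpow_right₀ hs.le (by omega)) hR.le
    · right
      exact mul_le_mul_of_nonneg_left (zpow_le_zpow_right₀ hs.le (by omega)) hR.le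
  · rw [← norm_pos_iff, hy]
    positivity

theorem Separated.norm_div_le {m : ℕ} {ρ s : ℝ} {y : Fin (m + 1) → ℂ} (h : Separated ρ s y)
    (hs : 1 < s) {i j : Fin (m + 1)} (hij : i ≠ j) :
    y i - y j ≠ 0 ∧ ‖y i / (y i - y j)‖ ≤ s / (s - 1) ∧ ‖y j / (y i - y j)‖ ≤ s / (s - 1) := by
  have h1 := h.sep i j hij 0
  rw [zpow_zero, one_mul] at h1
  have hi := norm_pos_iff.2 (h.ne_zero i)
  have hj := norm_pos_iff.2 (h.ne_zero j)
  have t1 := norm_sub_norm_le (y i) (y j)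
  have t2 := norm_sub_norm_le (y j) (y i)
  rw [norm_sub_rev] at t2
  have hpos : 0 < ‖y i - y j‖ := by
    rcases h1 with h1 | h1 <;> nlinarith
  refine ⟨norm_pos_iff.1 hpos, ?_, ?_⟩ <;>
    rw [norm_div, div_le_div_iff₀ hpos (by linarith)] <;>
    rcases h1 with h1 | h1 <;> nlinarith

/-- The majorant attached to the composition `κ`. -/
def major {m : ℕ} (ρ : ℝ) (κ : Fin (m + 1) → ℕ) (y : Fin (m + 1) → ℂ) : ℝ :=
  (ρ ^ nstat' κ)⁻¹ * ∏ i, (‖y i‖ + 1) ^ κ i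

theorem nstat'_comp (u : Fin n → ℕ) (σ : Equiv.Perm (Fin n)) : nstat' (u ∘ σ) = nstat' u :=
  Equiv.sum_comp σ fun i => (u i).choose 2

theorem major_comp {m : ℕ} (ρ : ℝ) (κ : Fin (m + 1) → ℕ) (y : Fin (m + 1) → ℂ)
    (σ : Equiv.Perm (Fin (m + 1))) : major ρ (κ ∘ σ) (y ∘ σ) = major ρ κ y := by
  rw [major, major, nstat'_comp, ← Equiv.prod_comp σ fun i => (‖y i‖ + 1) ^ κ i]
  rfl

theorem major_nonneg {m : ℕ} {ρ : ℝ} (hρ : 0 ≤ ρ) (κ : Fin (m + 1) → ℕ)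
    (y : Fin (m + 1) → ℂ) : 0 ≤ major ρ κ y :=
  mul_nonneg (inv_nonneg.2 (pow_nonneg hρ _)) (Finset.prod_nonneg fun _ _ => by positivity)

theorem major_unrot_le {m : ℕ} {q : ℂ} (hq : q ≠ 0) (hq1 : ‖q‖ ≤ 1) (κ : Fin (m + 1) → ℕ)
    (y : Fin (m + 1) → ℂ) :
    (‖y (Fin.last m)‖ + 1) * major ‖q‖ κ (unrot q y) ≤ major ‖q‖ (phi κ) y := by
  have hq' : 0 < ‖q‖ := norm_pos_iff.2 hq
  rw [major, major, nstat'_phi, Fin.prod_univ_succ, Fin.prod_univ_castSucc (n := m)]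
  simp only [unrot_zero, unrot_succ, phi_castSucc, phi_last, pow_succ, pow_add, norm_div, mul_inv]
  set Y := ‖y (Fin.last m)‖
  set P := ∏ i : Fin m, (‖y i.castSucc‖ + 1) ^ κ i.succ
  have hY : 0 ≤ Y := norm_nonneg _
  have hP : 0 ≤ P := Finset.prod_nonneg fun _ _ => by positivity
  have h1 : (Y / ‖q‖ + 1) ^ κ 0 ≤ (‖q‖ ^ κ 0)⁻¹ * (Y + 1) ^ κ 0 := by
    rw [← inv_pow, ← mul_pow]
    refine pow_le_pow_left₀ (by positivity) ?_ _
    have : 1 ≤ ‖q‖⁻¹ := (one_le_inv₀ hq').2 hq1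
    rw [div_eq_mul_inv]
    nlinarith
  have h2 : 0 ≤ (Y + 1) * (‖q‖ ^ nstat' κ)⁻¹ * P := by positivity
  calc (Y + 1) * ((‖q‖ ^ nstat' κ)⁻¹ * ((Y / ‖q‖ + 1) ^ κ 0 * P))
      = (Y + 1) * (‖q‖ ^ nstat' κ)⁻¹ * P * (Y / ‖q‖ + 1) ^ κ 0 := by ring
    _ ≤ (Y + 1) * (‖q‖ ^ nstat' κ)⁻¹ * P * ((‖q‖ ^ κ 0)⁻¹ * (Y + 1) ^ κ 0) :=
        mul_le_mul_of_nonneg_left h1 h2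
    _ = _ := by ring

/-- A bound for the polynomial `f` at separated points, by majorants below `u`. -/
def HasMajor {m : ℕ} (ρ s : ℝ) (f : MvPolynomial (Fin (m + 1)) ℂ) (u : Fin (m + 1) → ℕ)
    (B : ℝ) : Prop :=
  ∀ y, Separated ρ s y → ∃ κ, Below κ u ∧ ‖eval y f‖ ≤ B * (ρ ^ nstat' u * major ρ κ y)

theorem HasMajor.mono {m : ℕ} {ρ s : ℝ} (hρ : 0 ≤ ρ) {f : MvPolynomial (Fin (m + 1)) ℂ}
    {u : Fin (m + 1) → ℕ} {B B' : ℝ} (h : HasMajor ρ s f u B) (hB : B ≤ B') :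
    HasMajor ρ s f u B' := by
  intro y hy
  obtain ⟨κ, h1, h2⟩ := h y hy
  exact ⟨κ, h1, h2.trans (mul_le_mul_of_nonneg_right hB
    (mul_nonneg (pow_nonneg hρ _) (major_nonneg hρ _ _)))⟩

theorem IsNormalized.hasMajor_phi {m : ℕ} {q t : ℂ} (hg : Generic q t)
    {A : (Fin (m + 1) → ℕ) → MvPolynomial (Fin (m + 1)) ℂ} (hA : IsNormalized q t A) (s : ℝ) :
    ∃ L : ℝ, 1 ≤ L ∧ ∀ (u : Fin (m + 1) → ℕ) (B : ℝ), 0 ≤ B → HasMajor ‖q‖ s (A u) u B →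
      HasMajor ‖q‖ s (A (LRW.phi u)) (LRW.phi u) (L * B) := by
  obtain ⟨T, hT1, hT⟩ := exists_norm_pow_le t m
  obtain ⟨E, hE⟩ := exists_norm_inv_le hg m
  refine ⟨max 1 (E * T), le_max_left _ _, fun u B hB h y hy => ?_⟩
  have hq0 := hg.q_ne
  obtain ⟨κ, h1, h2⟩ := h (unrot q y) (hy.unrot hq0)
  refine ⟨LRW.phi κ, h1.phi, ?_⟩
  have hne := sub_ne_zero.2 (spec_phi_last_ne_one hg u)
  have h3 := congrArg (eval y) (hA.phi hg u)
  simp only [map_mul, map_sub, eval_C, eval_X, eval_punrotate] at h3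
  have h4 : eval y (A (LRW.phi u)) = (spec q t (LRW.phi u) (Fin.last m) - 1)⁻¹ *
      (-(q ^ u 0 * t ^ (m - lp (LRW.phi u) (Fin.last m))) *
        ((y (Fin.last m) - 1) * eval (unrot q y) (A u))) := by
    rw [← h3]; field_simp
  have h5 : ‖(spec q t (LRW.phi u) (Fin.last m) - 1)⁻¹‖ ≤ E := by
    have := hE (u 0 + 1) 0 (m - lp (LRW.phi u) (Fin.last m)) (by omega) (by omega) (by omega)
    simpa [spec] using this
  have h6 := hT (m - lp (LRW.phi u) (Fin.last m)) (by omega)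
  have h7 : ‖y (Fin.last m) - 1‖ ≤ ‖y (Fin.last m)‖ + 1 :=
    (norm_sub_le _ _).trans_eq (by simp)
  have h8 := major_unrot_le hq0 hg.q_lt.le κ y
  have hE0 : 0 ≤ E := (norm_nonneg _).trans h5
  have hM := major_nonneg (norm_nonneg q) κ (unrot q y)
  rw [h4, norm_mul, norm_mul, norm_mul, norm_neg, norm_mul, norm_pow q, nstat'_phi, pow_add]
  calc _ ≤ E * (‖q‖ ^ u 0 * T * ((‖y (Fin.last m)‖ + 1) *
        (B * (‖q‖ ^ nstat' u * major ‖q‖ κ (unrot q y))))) := by gcongr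
    _ = E * T * B * (‖q‖ ^ nstat' u * ‖q‖ ^ u 0) *
        ((‖y (Fin.last m)‖ + 1) * major ‖q‖ κ (unrot q y)) := by ring
    _ ≤ max 1 (E * T) * B * (‖q‖ ^ nstat' u * ‖q‖ ^ u 0) * major ‖q‖ (LRW.phi κ) y := by
        have h9 := le_max_right 1 (E * T)
        gcongr
    _ = _ := by ring

theorem IsNormalized.hasMajor_adj {m : ℕ} {q t : ℂ} (hg : Generic q t)
    {A : (Fin (m + 1) → ℕ) → MvPolynomial (Fin (m + 1)) ℂ} (hA : IsNormalized q t A) {s : ℝ}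
    (hs : 1 < s) :
    ∃ L : ℝ, 1 ≤ L ∧ ∀ (u : Fin (m + 1) → ℕ) (k : Fin m) (B : ℝ), u k.castSucc < u k.succ →
      0 ≤ B → HasMajor ‖q‖ s (A u) u B →
      HasMajor ‖q‖ s (A (u ∘ adj k)) (u ∘ adj k) (L * B) := by
  obtain ⟨T, hT1, hT⟩ := exists_norm_pow_le t (m + 1)
  obtain ⟨E, hE⟩ := exists_norm_inv_le hg (m + 1)
  set S := s / (s - 1) with hS
  have hS0 : 0 ≤ S := div_nonneg (by linarith) (by linarith)
  set W := ‖t‖ + 1 with hW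
  have hW0 : 0 ≤ W := by positivity
  refine ⟨max 1 (2 * T * E * (W * S + W * S) + W * T * E), le_max_left _ _,
    fun u k B hk hB h z hz => ?_⟩
  obtain ⟨κ₁, a1, a2⟩ := h z hz
  obtain ⟨κ₂, b1, b2⟩ := h (z ∘ adj k) (hz.comp _)
  obtain ⟨hne, n1, n2⟩ := hz.norm_div_le hs (i := k.castSucc) (j := k.succ) (by simp [Fin.ext_iff])
  obtain ⟨κ, c1, c2, c3⟩ : ∃ κ, Below κ (u ∘ adj k) ∧
      ‖eval z (A u)‖ ≤ B * (‖q‖ ^ nstat' u * major ‖q‖ κ z) ∧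
      ‖eval (z ∘ adj k) (A u)‖ ≤ B * (‖q‖ ^ nstat' u * major ‖q‖ κ z) := by
    have b3 : major ‖q‖ κ₂ (z ∘ adj k) = major ‖q‖ (κ₂ ∘ adj k) z := by
      rw [← major_comp _ _ _ (adj k), comp_adj_comp_adj]
    rw [b3] at b2
    rcases le_total (major ‖q‖ κ₁ z) (major ‖q‖ (κ₂ ∘ adj k) z) with hle | hle
    · exact ⟨_, (b1.adj k hk).2, a2.trans (by gcongr), b2⟩
    · exact ⟨_, (a1.adj k hk).1, a2, b2.trans (by gcongr)⟩
  refine ⟨κ, c1, ?_⟩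
  rw [nstat'_comp]
  set M := B * (‖q‖ ^ nstat' u * major ‖q‖ κ z) with hM
  have hM0 : 0 ≤ M := (norm_nonneg _).trans c2
  have h1 := hA.hecke hg u k hk.ne z hne
  obtain ⟨D, hD⟩ := Nat.exists_eq_add_of_lt hk
  set e := m - lp u k.castSucc with he
  set f := m - lp u k.succ with hf
  have hx : spec q t u k.castSucc = q ^ u k.castSucc * t ^ e := by simp [spec, he]
  have hy : spec q t u k.succ = q ^ u k.castSucc * (q ^ (D + 1) * t ^ f) := by
    rw [spec, hD, hf]; simp only [Nat.add_sub_cancel]; ring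
  have hd : q ^ (D + 1) * t ^ f - t ^ (e + 1) ≠ 0 := by
    intro h0
    have := (hg.pow_inj (a := D + 1) (b := f) (c := 0) (d := e + 1)
      (by rw [pow_zero, one_mul]; exact sub_eq_zero.1 h0)).1
    omega
  have hq0 := pow_ne_zero (u k.castSucc) hg.q_ne
  have h2 : eval z (A (u ∘ adj k)) =
      (q ^ (D + 1) * t ^ f - t ^ e) * (q ^ (D + 1) * t ^ f - t ^ (e + 1))⁻¹ *
        ((t - 1) * (z k.castSucc / (z k.castSucc - z k.succ)) * eval z (A u) +
          (z k.castSucc / (z k.castSucc - z k.succ) -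
            t * (z k.succ / (z k.castSucc - z k.succ))) * eval (z ∘ adj k) (A u)) +
        (t - 1) * t ^ e * (q ^ (D + 1) * t ^ f - t ^ (e + 1))⁻¹ * eval z (A u) := by
    rw [hx, hy] at h1
    have h3 : q ^ u k.castSucc * (q ^ (D + 1) * t ^ f - t ^ (e + 1)) * eval z (A (u ∘ adj k)) =
      q ^ u k.castSucc * ((q ^ (D + 1) * t ^ f - t ^ e) *
        ((t - 1) * (z k.castSucc / (z k.castSucc - z k.succ)) * eval z (A u) +
          (z k.castSucc / (z k.castSucc - z k.succ) -
            t * (z k.succ / (z k.castSucc - z k.succ))) * eval (z ∘ adj k) (A u)) +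
        (t - 1) * t ^ e * eval z (A u)) := by
      rw [show q ^ u k.castSucc * (q ^ (D + 1) * t ^ f - t ^ (e + 1)) =
        q ^ u k.castSucc * (q ^ (D + 1) * t ^ f) - t * (q ^ u k.castSucc * t ^ e) by ring, h1]
      ring
    rw [mul_assoc] at h3
    have h4 := mul_left_cancel₀ hq0 h3
    rw [(eq_div_iff hd).2 ((mul_comm _ _).trans h4)]
    ring
  have i1 := hE (D + 1) (e + 1) f (by omega) (by omega) (by omega)
  have hE0 : 0 ≤ E := (norm_nonneg _).trans i1
  have i2 : ‖q ^ (D + 1) * t ^ f - t ^ e‖ ≤ 2 * T := by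
    refine (norm_sub_le _ _).trans ?_
    rw [norm_mul, norm_pow]
    have j1 := hT e (by omega)
    have j2 := hT f (by omega)
    have j3 : ‖q‖ ^ (D + 1) ≤ 1 := pow_le_one₀ (norm_nonneg _) hg.q_lt.le
    have j4 : ‖q‖ ^ (D + 1) * ‖t ^ f‖ ≤ 1 * T := by gcongr
    linarith
  have i3 : ‖t - 1‖ ≤ W := (norm_sub_le _ _).trans_eq (by simp [hW])
  have i4 : ‖z k.castSucc / (z k.castSucc - z k.succ) -
      t * (z k.succ / (z k.castSucc - z k.succ))‖ ≤ W * S := by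
    refine (norm_sub_le _ _).trans ?_
    rw [norm_mul, hW]
    have := mul_le_mul_of_nonneg_left n2 (norm_nonneg t)
    linarith
  have i5 := hT e (by omega)
  rw [h2]
  calc _ ≤ 2 * T * E * (W * S * M + W * S * M) + W * T * E * M := by
        refine (norm_add_le _ _).trans (add_le_add ?_ ?_)
        · rw [norm_mul, norm_mul]
          refine mul_le_mul (mul_le_mul i2 i1 (norm_nonneg _) (by linarith)) ?_ (norm_nonneg _)
            (by positivity)
          refine (norm_add_le _ _).trans (add_le_add ?_ ?_)
          · rw [norm_mul, norm_mul]; gcongr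
          · rw [norm_mul]; gcongr
        · rw [norm_mul, norm_mul, norm_mul]; gcongr
    _ = (2 * T * E * (W * S + W * S) + W * T * E) * M := by ring
    _ ≤ max 1 (2 * T * E * (W * S + W * S) + W * T * E) * M := by
        gcongr; exact le_max_right _ _
    _ = _ := by rw [hM]; ring

theorem IsNormalized.exists_hasMajor {m : ℕ} {q t : ℂ} (hg : Generic q t)
    {A : (Fin (m + 1) → ℕ) → MvPolynomial (Fin (m + 1)) ℂ} (hA : IsNormalized q t A) {s : ℝ}
    (hs : 1 < s) : ∃ K : ℝ, 1 ≤ K ∧ ∀ u, HasMajor ‖q‖ s (A u) u (K ^ wt u) := by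
  obtain ⟨L₁, hL₁, h1⟩ := hA.hasMajor_phi hg s
  obtain ⟨L₂, hL₂, h2⟩ := hA.hasMajor_adj hg hs
  have hK : 1 ≤ L₂ ^ m * L₁ := one_le_mul_of_one_le_of_one_le (one_le_pow₀ hL₂) hL₁
  refine ⟨L₂ ^ m * L₁, hK, fun u => ?_⟩
  induction hd : wt u generalizing u with
  | zero =>
    intro y _
    have h0 : ∀ i, u i = 0 := fun i => Nat.eq_zero_of_le_zero ((le_wt u i).trans_eq hd)
    refine ⟨u, ⟨rfl, fun _ => le_rfl⟩, ?_⟩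
    have hc := (totalDegree_eq_zero_iff_eq_C).1 (Nat.eq_zero_of_le_zero ((hA.deg_le u).trans_eq hd))
    have hm := hA.diag u
    rw [hc, eval_C] at hm
    rw [hc, eval_C, hm]
    simp [mval, major, nstat', h0]
  | succ d ih =>
    have step : ∀ p : Fin (m + 1), ∀ u : Fin (m + 1) → ℕ, wt u = d + 1 → u p ≠ 0 →
        (∀ i, p < i → u i = 0) →
        HasMajor ‖q‖ s (A u) u (L₂ ^ (m - p : ℕ) * (L₁ * (L₂ ^ m * L₁) ^ d)) := by
      intro p
      induction p using Fin.reverseInduction with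
      | last =>
        intro u hu hp _
        rcases exists_phi_or_app u with ⟨w, rfl⟩ | ⟨w, rfl⟩
        · rw [wt_phi] at hu
          have := h1 w _ (by positivity) (ih w (by omega))
          simpa using this
        · simp at hp
      | cast k ihk =>
        intro u hu hp hz
        have h3 := ihk (u ∘ adj k) ((wt_comp _ _).trans hu) (by simpa using hp) (by
          intro i hi
          have hi' : k.succ < i := hi
          rw [Function.comp, adj, Equiv.swap_apply_of_ne_of_ne
            ((Fin.castSucc_lt_succ).trans hi').ne' hi'.ne']
          exact hz i ((Fin.castSucc_lt_succ).trans hi'))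
        have h4 := h2 (u ∘ adj k) k _ (by
          simp only [Function.comp, adj_castSucc, adj_succ]
          rw [hz _ Fin.castSucc_lt_succ]
          exact Nat.pos_of_ne_zero hp) (by positivity) h3
        rw [comp_adj_comp_adj] at h4
        have h5 : m - (k.castSucc : ℕ) = m - (k.succ : ℕ) + 1 := by
          simp only [Fin.val_castSucc, Fin.val_succ]; omega
        rw [h5, pow_succ']
        simpa only [mul_assoc] using h4
    obtain ⟨p, hp, hz⟩ : ∃ p, u p ≠ 0 ∧ ∀ i, p < i → u i = 0 := by
      have hne : (Finset.univ.filter fun i => u i ≠ 0).Nonempty := by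
        by_contra hne
        rw [Finset.not_nonempty_iff_eq_empty, Finset.filter_eq_empty_iff] at hne
        have : wt u = 0 := Finset.sum_eq_zero fun i hi => not_not.1 (hne hi)
        omega
      refine ⟨_, (Finset.mem_filter.1 (Finset.max'_mem _ hne)).2, fun i hi => ?_⟩
      by_contra h0
      exact absurd (Finset.le_max' _ i (Finset.mem_filter.2 ⟨Finset.mem_univ _, h0⟩)) (not_le.2 hi)
    refine (step p u hd hp hz).mono (norm_nonneg _) ?_
    rw [pow_succ', mul_assoc (L₂ ^ m)]
    gcongr
    omega

theorem differentiable_eval_update (f : MvPolynomial (Fin n) ℂ) (x : Fin n → ℂ) (j : Fin n) :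
    Differentiable ℂ fun z : ℂ => eval (Function.update x j z) f := by
  induction f using MvPolynomial.induction_on with
  | C a => simp
  | add p p' hp hp' =>
    simp only [map_add]
    exact hp.add hp'
  | mul_X p i hp =>
    simp only [map_mul, eval_X]
    refine hp.mul ?_
    by_cases hij : i = j
    · subst hij; simp
    · simp [hij]

theorem norm_eval_le_of_torus (f : MvPolynomial (Fin n) ℂ) {r : Fin n → ℝ} (hr : ∀ i, 0 < r i)
    {B : ℝ} (h : ∀ y, (∀ i, ‖y i‖ = r i) → ‖eval y f‖ ≤ B) {x : Fin n → ℂ}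
    (hx : ∀ i, ‖x i‖ ≤ r i) : ‖eval x f‖ ≤ B := by
  have key : ∀ (S : Finset (Fin n)) (x : Fin n → ℂ), (∀ i, ‖x i‖ ≤ r i) →
      (∀ i, i ∉ S → ‖x i‖ = r i) → ‖eval x f‖ ≤ B := by
    intro S
    induction S using Finset.induction_on with
    | empty => exact fun x _ h2 => h x fun i => h2 i (by simp)
    | insert j S _ ih =>
      intro x h1 h2
      have hd := differentiable_eval_update f x j
      have h3 := Complex.norm_le_of_forall_mem_frontier_norm_le (U := Metric.ball 0 (r j))
        Metric.isBounded_ball hd.diffContOnCl (C := B) (fun z hz => ?_) (z := x j) ?_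
      · rwa [Function.update_eq_self] at h3
      · rw [frontier_ball _ (hr j).ne', mem_sphere_zero_iff_norm] at hz
        refine ih _ (fun i => ?_) fun i hi => ?_
        · by_cases hij : i = j
          · subst hij; simp [hz]
          · simpa [hij] using h1 i
        · by_cases hij : i = j
          · subst hij; simp [hz]
          · simpa [hij] using h2 i (by simp [hij, hi])
      · rw [closure_ball _ (hr j).ne']
        simpa using h1 j
  exact key Finset.univ x hx (by simp)

theorem IsNormalized.exists_norm_eval_le {m : ℕ} {q t : ℂ} (hg : Generic q t)
    {A : (Fin (m + 1) → ℕ) → MvPolynomial (Fin (m + 1)) ℂ} (hA : IsNormalized q t A) {R : ℝ}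
    (hR : 0 < R) : ∃ K : ℝ, 1 ≤ K ∧ ∀ u x, (∀ i, ‖x i‖ ≤ R) → ‖eval x (A u)‖ ≤ K ^ wt u := by
  have hq : 0 < ‖q‖ := norm_pos_iff.2 hg.q_ne
  set s : ℝ := ‖q‖⁻¹ ^ ((m + 1 : ℕ) : ℝ)⁻¹ with hs
  have hs1 : 1 < s := Real.one_lt_rpow ((one_lt_inv₀ hq).2 hg.q_lt) (by positivity)
  have hρ : ‖q‖ * s ^ (m + 1) = 1 := by
    rw [hs, Real.rpow_inv_natCast_pow (by positivity) (Nat.succ_ne_zero m), mul_inv_cancel₀ hq.ne']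
  obtain ⟨K, hK1, hK⟩ := hA.exists_hasMajor hg hs1
  set R' := R * s ^ m + 1 with hR'
  have hR1 : 1 ≤ R' := by rw [hR']; linarith [show 0 ≤ R * s ^ m by positivity]
  refine ⟨K * R', one_le_mul_of_one_le_of_one_le hK1 hR1, fun u x hx => ?_⟩
  refine norm_eval_le_of_torus (A u) (r := fun i => R * s ^ (i : ℕ)) (fun i => by positivity)
    (fun y hy => ?_) fun i => (hx i).trans (le_mul_of_one_le_right hR.le (one_le_pow₀ hs1.le))
  obtain ⟨κ, h1, h2⟩ := hK u y (Separated.of_norm_eq hs1 hR hρ hy)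
  refine h2.trans ?_
  rw [mul_pow]
  refine mul_le_mul_of_nonneg_left ?_ (by positivity)
  have h3 : ‖q‖ ^ nstat' u * (‖q‖ ^ nstat' κ)⁻¹ ≤ 1 := by
    rw [← div_eq_mul_inv, div_le_one (by positivity)]
    exact pow_le_pow_of_le_one hq.le hg.q_lt.le h1.nstat'_le
  have h4 : ∏ i, (‖y i‖ + 1) ^ κ i ≤ R' ^ wt u := by
    rw [← h1.wt_eq, wt, ← Finset.prod_pow_eq_pow_sum]
    refine Finset.prod_le_prod (fun i _ => by positivity) fun i _ => ?_
    refine pow_le_pow_left₀ (by positivity) ?_ _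
    rw [hy, hR']
    have := pow_le_pow_right₀ hs1.le (Nat.lt_succ_iff.1 i.2)
    gcongr
  rw [major, ← mul_assoc]
  exact (mul_le_mul h3 h4 (Finset.prod_nonneg fun i _ => by positivity) zero_le_one).trans_eq
    (one_mul _)

theorem summable_pow_wt {r : ℝ} (h0 : 0 ≤ r) (h1 : r < 1) :
    Summable fun u : Fin n → ℕ => r ^ wt u := by
  induction n with
  | zero => exact (hasSum_fintype _).summable
  | succ m ih =>
    have h := (summable_geometric_of_lt_one h0 h1).mul_of_nonneg ih (fun _ => by positivity)
      (fun _ => by positivity)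
    rw [← (Fin.consEquiv fun _ : Fin (m + 1) => ℕ).summable_iff]
    refine h.congr fun p => ?_
    simp [wt, Fin.sum_univ_succ, pow_add]

theorem summable_norm_mul_pow {q : ℂ} (hq : ‖q‖ < 1) (z : ℂ) :
    Summable fun m : ℕ => ‖-(z * q ^ m)‖ := by
  simpa using (summable_geometric_of_lt_one (norm_nonneg _) hq).mul_left ‖z‖

theorem differentiable_qpochInf {q : ℂ} (hq : ‖q‖ < 1) :
    Differentiable ℂ fun z => qpochInf z q := by
  intro z
  have h : HasProdUniformlyOn (fun (m : ℕ) (z : ℂ) => 1 + -(z * q ^ m))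
      (fun z => ∏' m : ℕ, (1 + -(z * q ^ m))) (Metric.closedBall 0 (‖z‖ + 1)) := by
    refine ((summable_geometric_of_lt_one (norm_nonneg _) hq).mul_left
      (‖z‖ + 1)).hasProdUniformlyOn_nat_one_add (isCompact_closedBall _ _)
      (.of_forall fun m y hy => ?_) (fun _ => by fun_prop)
    rw [norm_neg, norm_mul, norm_pow]
    have : ‖y‖ ≤ ‖z‖ + 1 := by simpa using hy
    gcongr
  have h2 := (hasProdUniformlyOn_iff_tendstoUniformlyOn.1 h).mono
    Metric.ball_subset_closedBall |>.tendstoLocallyUniformlyOn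
  have h3 := h2.differentiableOn (.of_forall fun s => by
    simpa [Finset.prod_fn] using DifferentiableOn.finsetProd (fun _ _ => by fun_prop))
    Metric.isOpen_ball
  have h4 := h3.differentiableAt (x := z) (Metric.isOpen_ball.mem_nhds (by simp))
  simpa only [qpochInf, sub_eq_add_neg] using h4

theorem qpochInf_ne_zero {q z : ℂ} (hq : ‖q‖ < 1) (hz : ‖z‖ < 1) : qpochInf z q ≠ 0 := by
  simp only [qpochInf, sub_eq_add_neg]
  refine tprod_one_add_ne_zero_of_summable (fun m h => ?_) (summable_norm_mul_pow hq z)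
  have h1 : z * q ^ m = 1 := (add_neg_eq_zero.1 h).symm
  have h2 : ‖z * q ^ m‖ < 1 := by
    rw [norm_mul, norm_pow]
    exact mul_lt_one_of_nonneg_of_lt_one_left (norm_nonneg _) hz
      (pow_le_one₀ (norm_nonneg _) hq.le)
  rw [h1, norm_one] at h2
  exact lt_irrefl _ h2

theorem qpochInf_eq_prod_mul {q : ℂ} (hq : ‖q‖ < 1) (z : ℂ) (k : ℕ) :
    qpochInf z q = (∏ j ∈ Finset.range k, (1 - z * q ^ j)) * qpochInf (z * q ^ k) q := by
  have he (m : ℕ) : z * q ^ k * q ^ m = z * q ^ (m + k) := by ring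
  have h := multipliable_one_add_of_summable (summable_norm_mul_pow hq (z * q ^ k))
  simp only [he, ← sub_eq_add_neg] at h
  have h2 := Multipliable.prod_mul_tprod_nat_mul' (f := fun m => 1 - z * q ^ m) h
  simp only [qpochInf, he]
  exact h2.symm

/-- A function holomorphic on a disc about `0` and vanishing on almost all terms of a
geometric sequence vanishes on the disc. -/
theorem eq_zero_of_geometric_zeros {q s : ℂ} (hq0 : q ≠ 0) (hq : ‖q‖ < 1) (hs : s ≠ 0) {R : ℝ}
    {g : ℂ → ℂ} (hg : DifferentiableOn ℂ g (Metric.ball 0 R)) {N : ℕ}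
    (h : ∀ d, N ≤ d → g (q ^ d * s) = 0) {z : ℂ} (hz : ‖z‖ < R) : g z = 0 := by
  have hR : 0 < R := (norm_nonneg z).trans_lt hz
  have ht : Filter.Tendsto (fun d : ℕ => q ^ d * s) Filter.atTop (nhdsWithin 0 {0}ᶜ) := by
    rw [tendsto_nhdsWithin_iff]
    refine ⟨?_, .of_forall fun d => mul_ne_zero (pow_ne_zero _ hq0) hs⟩
    simpa using (tendsto_pow_atTop_nhds_zero_of_norm_lt_one hq).mul_const s
  refine (hg.analyticOnNhd Metric.isOpen_ball).eqOn_zero_of_preconnected_of_frequently_eq_zero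
    (convex_ball 0 R).isPreconnected (Metric.mem_ball_self hR)
    (ht.frequently (Filter.eventually_atTop.2 ⟨N, h⟩).frequently) (by simpa using hz)

theorem spec_of_strictAnti (q t : ℂ) {w : Fin n → ℕ} (hw : StrictAnti w) (i : Fin n) :
    spec q t w i = q ^ w i * t ^ (n - 1 - i) := by
  have h1 : (Finset.univ.filter fun k => i < k ∧ w i < w k) = ∅ :=
    Finset.filter_eq_empty_iff.2 fun k _ h => absurd (hw h.1) h.2.not_gt
  have h2 : (Finset.univ.filter fun k => k < i ∧ w i ≤ w k) = Finset.Iio i := by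
    ext k
    simpa using fun h => (hw h).le
  rw [spec, lp, h1, h2, Finset.card_empty, zero_add, Fin.card_Iio]

theorem eq_zero_of_spec_zeros {q t : ℂ} (hq0 : q ≠ 0) (hq : ‖q‖ < 1) (ht : t ≠ 0) {R : ℝ}
    {H : (Fin n → ℂ) → ℂ} (hR : ∀ e < n, ‖t ^ e‖ < R)
    (hH : ∀ x, (∀ i, ‖x i‖ < R) → ∀ j,
      DifferentiableOn ℂ (fun z => H (Function.update x j z)) (Metric.ball 0 R))
    (h : ∀ w, H (spec q t w) = 0) {x : Fin n → ℂ} (hx : ∀ i, ‖x i‖ < R) : H x = 0 := by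
  have key : ∀ k ≤ n, ∀ (x : Fin n → ℂ) (w : Fin n → ℕ), (∀ i, ‖x i‖ < R) →
      (∀ i j : Fin n, k ≤ i → i < j → w j < w i) →
      (∀ i : Fin n, k ≤ i → x i = q ^ w i * t ^ (n - 1 - i)) → H x = 0 := by
    intro k
    induction k with
    | zero =>
      intro _ x w _ hw hxw
      have hw' : StrictAnti w := fun i j hij => hw i j (Nat.zero_le _) hij
      rw [show x = spec q t w from funext fun i => by
        rw [spec_of_strictAnti q t hw', hxw i (Nat.zero_le _)]]
      exact h w
    | succ k ih =>
      intro hk x w hx hw hxw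
      set p : Fin n := ⟨k, hk⟩
      have h0 : ∀ d, wt w < d → H (Function.update x p (q ^ d * t ^ (n - 1 - k))) = 0 := by
        intro d hd
        refine ih (by omega) _ (Function.update w p d) (fun i => ?_) (fun i j hi hij => ?_)
          fun i hi => ?_
        · by_cases hip : i = p
          · subst hip
            rw [Function.update_self, norm_mul, norm_pow]
            exact (mul_le_of_le_one_left (norm_nonneg _)
              (pow_le_one₀ (norm_nonneg _) hq.le)).trans_lt (hR _ (by omega))
          · simpa [hip] using hx i
        · have hjp : j ≠ p := fun hjp => by
            have := hjp ▸ Fin.lt_def.1 hij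
            exact absurd hi (not_le.2 this)
          rw [Function.update_of_ne hjp]
          by_cases hip : i = p
          · rw [hip, Function.update_self]
            exact (le_wt w j).trans_lt hd
          · rw [Function.update_of_ne hip]
            exact hw i j (lt_of_le_of_ne hi fun h => hip (Fin.ext h.symm)) hij
        · by_cases hip : i = p
          · subst hip; simp [p]
          · rw [Function.update_of_ne hip, Function.update_of_ne hip]
            exact hxw i (lt_of_le_of_ne hi fun h => hip (Fin.ext h.symm))
      have h1 := eq_zero_of_geometric_zeros hq0 hq (pow_ne_zero (n - 1 - k) ht) (hH x hx p)
        (N := wt w + 1) h0 (hx p)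
      simpa using h1
  exact key n le_rfl x 0 hx (fun i _ hi => absurd i.2 hi.not_gt)
    (fun i hi => absurd i.2 hi.not_gt)

theorem prod_cells_const {R : Type*} [CommMonoid R] (a : R) (u : Fin n → ℕ) :
    ∏ i, ∏ _j ∈ Finset.range (u i), a = a ^ wt u := by
  simp [wt, Finset.prod_pow_eq_pow_sum]

section Bounds

variable {q t : ℂ} {T : ℝ}

theorem norm_cell_le (hq : ‖q‖ < 1) (hT : ∀ e ≤ n, ‖t ^ e‖ ≤ T) (j : ℕ) (u : Fin n → ℕ)
    (i : Fin n) : ‖q ^ j * t ^ (n - 1 - lp u i)‖ ≤ T := by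
  rw [norm_mul, norm_pow]
  exact (mul_le_of_le_one_left (norm_nonneg _) (pow_le_one₀ (norm_nonneg _) hq.le)).trans
    (hT _ (by omega))

theorem norm_pow_mul_cfac_le (hq : ‖q‖ < 1) (hT : ∀ e ≤ n, ‖t ^ e‖ ≤ T) (a s : ℂ)
    (u : Fin n → ℕ) : ‖a ^ wt u * cfac q t s u‖ ≤ (‖a‖ + ‖a * s‖ * T) ^ wt u := by
  rw [cfac, ← prod_cells_const, ← prod_cells_const, ← Finset.prod_mul_distrib]
  simp only [← Finset.prod_mul_distrib, norm_prod]
  refine Finset.prod_le_prod (fun _ _ => Finset.prod_nonneg fun _ _ => norm_nonneg _) fun i _ =>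
    Finset.prod_le_prod (fun _ _ => norm_nonneg _) fun j _ => ?_
  rw [mul_sub, mul_one, ← mul_assoc]
  refine (norm_sub_le _ _).trans ?_
  rw [norm_mul (a * s)]
  have := norm_cell_le hq hT j u i
  gcongr

theorem le_norm_cfac (hq : ‖q‖ < 1) (hT : ∀ e ≤ n, ‖t ^ e‖ ≤ T) {s : ℂ} (hs : ‖s‖ * T ≤ 1 / 2)
    (u : Fin n → ℕ) : (1 / 2) ^ wt u ≤ ‖cfac q t s u‖ := by
  rw [cfac, ← prod_cells_const]
  simp only [norm_prod]
  refine Finset.prod_le_prod (fun _ _ => by positivity) fun i _ =>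
    Finset.prod_le_prod (fun _ _ => by positivity) fun j _ => ?_
  have h1 := norm_sub_norm_le 1 (s * (q ^ j * t ^ (n - 1 - lp u i)))
  have h2 := mul_le_mul_of_nonneg_left (norm_cell_le hq hT j u i) (norm_nonneg s)
  rw [norm_one, norm_mul] at h1
  linarith

theorem cfac_ne_zero (hq : ‖q‖ < 1) (hT : ∀ e ≤ n, ‖t ^ e‖ ≤ T) {s : ℂ} (hs : ‖s‖ * T ≤ 1 / 2)
    (u : Fin n → ℕ) : cfac q t s u ≠ 0 := by
  rw [← norm_pos_iff]
  exact (by positivity : (0 : ℝ) < (1 / 2) ^ wt u).trans_le (le_norm_cfac hq hT hs u)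

end Bounds

/-- The general term of the series in the Heine transformation. -/
def heineTerm (q t : ℂ) (A : (Fin n → ℕ) → MvPolynomial (Fin n) ℂ) (v : Fin n → ℕ) (a b c : ℂ)
    (u : Fin n → ℕ) (x : Fin n → ℂ) : ℂ :=
  a ^ wt u * (cfac q t b u / cfac q t c u) * (eval (spec q t u) (A v) / mval q t v) *
    eval x (A u)

theorem norm_heineTerm_le {q t : ℂ} {T R K : ℝ} (hq : ‖q‖ < 1) (hT : ∀ e ≤ n, ‖t ^ e‖ ≤ T)
    (hTR : T ≤ R) (hK : 1 ≤ K) {A : (Fin n → ℕ) → MvPolynomial (Fin n) ℂ}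
    (hA : ∀ u x, (∀ i, ‖x i‖ ≤ R) → ‖eval x (A u)‖ ≤ K ^ wt u) (v : Fin n → ℕ) {a b c : ℂ}
    (hc : ‖c‖ * T ≤ 1 / 2) (hab : (‖a‖ + ‖a * b‖ * T) * K ≤ 1 / 4) (u : Fin n → ℕ)
    {x : Fin n → ℂ} (hx : ∀ i, ‖x i‖ ≤ R) :
    ‖heineTerm q t A v a b c u x‖ ≤ K ^ wt v / ‖mval q t v‖ * (1 / 2) ^ wt u := by
  have h1 := norm_pow_mul_cfac_le hq hT a b u
  have h2 := le_norm_cfac hq hT hc u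
  have h3 := hA u x hx
  have h4 := hA v (spec q t u) fun i => (norm_cell_le hq hT _ u i).trans hTR
  have hT0 : 0 ≤ T := (norm_nonneg _).trans (hT 0 (Nat.zero_le _))
  have h5 : 0 < ‖cfac q t c u‖ := (by positivity : (0 : ℝ) < (1 / 2) ^ wt u).trans_le h2
  have h6 : ‖cfac q t c u‖⁻¹ ≤ 2 ^ wt u := by
    rw [inv_le_comm₀ h5 (by positivity)]
    simpa using h2
  calc ‖heineTerm q t A v a b c u x‖
      = ‖eval (spec q t u) (A v)‖ / ‖mval q t v‖ *
        (‖a ^ wt u * cfac q t b u‖ * ‖cfac q t c u‖⁻¹ * ‖eval x (A u)‖) := by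
        simp only [heineTerm, norm_mul, norm_div]; ring
    _ ≤ K ^ wt v / ‖mval q t v‖ * ((‖a‖ + ‖a * b‖ * T) ^ wt u * 2 ^ wt u * K ^ wt u) := by
        gcongr
    _ = K ^ wt v / ‖mval q t v‖ * ((‖a‖ + ‖a * b‖ * T) * K * 2) ^ wt u := by
        simp only [mul_pow]; ring
    _ ≤ _ := by
        gcongr
        linarith

theorem prod_qpochInf_spec {q : ℂ} (hq : ‖q‖ < 1) (t a : ℂ) (w : Fin n → ℕ) :
    ∏ i : Fin n, qpochInf (a * t ^ (n - 1 - (i : ℕ))) q =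
      cfac q t a w * ∏ i, qpochInf (a * spec q t w i) q := by
  rw [Fin.prod_univ_eq_prod_range (fun i => qpochInf (a * t ^ (n - 1 - i)) q),
    ← prod_lp_eq (fun i => qpochInf (a * t ^ (n - 1 - i)) q) w, cfac, ← Finset.prod_mul_distrib]
  refine Finset.prod_congr rfl fun i _ => ?_
  rw [qpochInf_eq_prod_mul hq _ (w i), spec]
  congr 1
  · refine Finset.prod_congr rfl fun j _ => ?_
    ring
  · congr 1
    ring

theorem differentiable_prod_qpochInf_update {q : ℂ} (hq : ‖q‖ < 1) (a : ℂ) (x : Fin n → ℂ)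
    (j : Fin n) : Differentiable ℂ fun z => ∏ i, qpochInf (a * Function.update x j z i) q := by
  refine Differentiable.fun_finsetProd fun i _ => ?_
  by_cases hij : i = j
  · subst hij
    simp only [Function.update_self]
    exact (differentiable_qpochInf hq).comp (differentiable_id.const_mul a)
  · simp [hij]

theorem summable_norm_heineTerm {q t : ℂ} {T R K : ℝ} (hq : ‖q‖ < 1) (hT : ∀ e ≤ n, ‖t ^ e‖ ≤ T)
    (hTR : T ≤ R) (hK : 1 ≤ K) {A : (Fin n → ℕ) → MvPolynomial (Fin n) ℂ}
    (hA : ∀ u x, (∀ i, ‖x i‖ ≤ R) → ‖eval x (A u)‖ ≤ K ^ wt u) (v : Fin n → ℕ) {a b c : ℂ}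
    (hc : ‖c‖ * T ≤ 1 / 2) (hab : (‖a‖ + ‖a * b‖ * T) * K ≤ 1 / 4)
    {x : Fin n → ℂ} (hx : ∀ i, ‖x i‖ ≤ R) : Summable fun u => ‖heineTerm q t A v a b c u x‖ :=
  .of_nonneg_of_le (fun _ => norm_nonneg _)
    (fun u => norm_heineTerm_le hq hT hTR hK hA v hc hab u hx)
    ((summable_pow_wt (by norm_num) (by norm_num)).mul_left _)

theorem differentiableOn_tsum_heineTerm {q t : ℂ} {T R K : ℝ} (hq : ‖q‖ < 1)
    (hT : ∀ e ≤ n, ‖t ^ e‖ ≤ T) (hTR : T ≤ R) (hK : 1 ≤ K)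
    {A : (Fin n → ℕ) → MvPolynomial (Fin n) ℂ}
    (hA : ∀ u x, (∀ i, ‖x i‖ ≤ R) → ‖eval x (A u)‖ ≤ K ^ wt u) (v : Fin n → ℕ) {a b c : ℂ}
    (hc : ‖c‖ * T ≤ 1 / 2) (hab : (‖a‖ + ‖a * b‖ * T) * K ≤ 1 / 4)
    {x : Fin n → ℂ} (hx : ∀ i, ‖x i‖ ≤ R) (j : Fin n) :
    DifferentiableOn ℂ (fun z => ∑' u, heineTerm q t A v a b c u (Function.update x j z))
      (Metric.ball 0 R) := by
  refine Complex.differentiableOn_tsum_of_summable_norm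
    ((summable_pow_wt (r := 1 / 2) (by norm_num) (by norm_num)).mul_left
      (K ^ wt v / ‖mval q t v‖)) (fun u => ?_) Metric.isOpen_ball fun u z hz =>
    norm_heineTerm_le hq hT hTR hK hA v hc hab u fun i => ?_
  · exact ((differentiable_eval_update (A u) x j).const_mul _).differentiableOn
  · by_cases hij : i = j
    · subst hij
      simpa using (mem_ball_zero_iff.1 hz).le
    · simpa [hij] using hx i

theorem IsNormalized.tsum_heineTerm_spec {q t : ℂ} {A : (Fin n → ℕ) → MvPolynomial (Fin n) ℂ}
    (hA : IsNormalized q t A) (v w : Fin n → ℕ) (a b c : ℂ) {D : ℕ} (hw : wt w ≤ D) :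
    ∑' u, heineTerm q t A v a b c u (spec q t w) =
      ∑ u ∈ comps n D, heineTerm q t A v a b c u (spec q t w) := by
  refine tsum_eq_sum fun u hu => ?_
  rw [mem_comps, not_le] at hu
  rw [heineTerm, hA.vanish u w (hw.trans hu.le) fun h => by subst h; omega, mul_zero]

theorem IsNormalized.heine {q t : ℂ} (hg : Generic q t)
    {A : (Fin n → ℕ) → MvPolynomial (Fin n) ℂ} (hA : IsNormalized q t A) {T R K : ℝ}
    (hT : ∀ e ≤ n, ‖t ^ e‖ ≤ T) (hTR : T < R) (hK : 1 ≤ K)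
    (hAK : ∀ u x, (∀ i, ‖x i‖ ≤ R) → ‖eval x (A u)‖ ≤ K ^ wt u) (v : Fin n → ℕ) {a b c g : ℂ}
    (hc0 : c ≠ 0) (ha : ‖a‖ * T ≤ 1 / 2) (hc : ‖c‖ * T ≤ 1 / 2)
    (hab : (‖a‖ + ‖a * b‖ * T) * K ≤ 1 / 4) (hcg : (‖c‖ + ‖c * g‖ * T) * K ≤ 1 / 4)
    (h : a * b = c * g) {x : Fin n → ℂ} (hx : ∀ i, ‖x i‖ < R) :
    (∑' u, heineTerm q t A v a b c u x) * (c ^ wt v * cfac q t g v) *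
        ((∏ i : Fin n, qpochInf (c * t ^ (n - 1 - (i : ℕ))) q) * ∏ i, qpochInf (a * x i) q) =
      (∑' u, heineTerm q t A v c g a u x) * (a ^ wt v * cfac q t b v) *
        ((∏ i : Fin n, qpochInf (a * t ^ (n - 1 - (i : ℕ))) q) * ∏ i, qpochInf (c * x i) q) := by
  have hq := hg.q_lt
  rw [← sub_eq_zero]
  refine eq_zero_of_spec_zeros (H := fun x => (∑' u, heineTerm q t A v a b c u x) *
    (c ^ wt v * cfac q t g v) *
        ((∏ i : Fin n, qpochInf (c * t ^ (n - 1 - (i : ℕ))) q) * ∏ i, qpochInf (a * x i) q) -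
      (∑' u, heineTerm q t A v c g a u x) * (a ^ wt v * cfac q t b v) *
        ((∏ i : Fin n, qpochInf (a * t ^ (n - 1 - (i : ℕ))) q) * ∏ i, qpochInf (c * x i) q))
    hg.q_ne hq hg.t_ne (fun e he => (hT e he.le).trans_lt hTR) (fun x hx j => ?_) (fun w => ?_) hx
  · have hx' i := (hx i).le
    have d1 := differentiableOn_tsum_heineTerm hq hT hTR.le hK hAK v hc hab hx' j
    have d2 := differentiableOn_tsum_heineTerm hq hT hTR.le hK hAK v ha hcg hx' j
    have d3 := (differentiable_prod_qpochInf_update hq a x j).differentiableOn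
      (s := Metric.ball 0 R)
    have d4 := (differentiable_prod_qpochInf_update hq c x j).differentiableOn
      (s := Metric.ball 0 R)
    exact ((d1.mul_const _).mul (d3.const_mul _)).sub ((d2.mul_const _).mul (d4.const_mul _))
  · have hca := cfac_ne_zero hq hT ha
    have hcc := cfac_ne_zero hq hT hc
    have h1 : (∑ u ∈ comps n (max (wt v) (wt w)), heineTerm q t A v a b c u (spec q t w)) *
        (c ^ wt v * cfac q t g v) = cfac q t a w / cfac q t c w * (a ^ wt v * cfac q t b v) *
          ∑ u ∈ comps n (max (wt v) (wt w)), heineTerm q t A v c g a u (spec q t w) :=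
      hA.heine_spec hg (le_max_left _ _) (le_max_right _ _) hc0 hca hcc h
    simp only [hA.tsum_heineTerm_spec v w _ _ _ (le_max_right (wt v) (wt w))]
    rw [h1, prod_qpochInf_spec hq t a w, prod_qpochInf_spec hq t c w, sub_eq_zero]
    have := hcc w
    field_simp

/-- **gl_n Heine transformation** (Corollary 8.2). -/
theorem gln_heine_transformation
    (hn : 0 < n) (q t : ℂ) (hq0 : q ≠ 0) (hq1 : ‖q‖ < 1) (ht : t ≠ 0)
    (hqt : ∀ i j : ℤ, ¬(i = 0 ∧ j = 0) → q ^ i * t ^ j ≠ 1)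
    (M : (Fin n → ℕ) → MvPolynomial (Fin n) ℂ) (hM : IsInterpFamily q t M)
    (b : ℂ) (v : Fin n → ℕ) (x : Fin n → ℂ) :
    ∃ ε > 0, ∀ a c : ℂ, 0 < ‖a‖ → ‖a‖ < ε → 0 < ‖c‖ → ‖c‖ < ε →
      qfac q t (a * b / c) v ≠ 0 →
      (∀ u : Fin n → ℕ, qfac q t (c * t ^ (n - 1)) u ≠ 0 ∧
        qfac q t (a * t ^ (n - 1)) u ≠ 0) ∧
      Summable (fun u : Fin n → ℕ =>
        ‖a ^ wt u * (qfac q t b u / qfac q t (c * t ^ (n - 1)) u) *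
          qbin q t M u v * eval x (MM q t M u)‖) ∧
      Summable (fun u : Fin n → ℕ =>
        ‖c ^ wt u * (qfac q t (a * b / c) u / qfac q t (a * t ^ (n - 1)) u) *
          qbin q t M u v * eval x (MM q t M u)‖) ∧
      ∑' u : Fin n → ℕ,
          a ^ wt u * (qfac q t b u / qfac q t (c * t ^ (n - 1)) u) *
            qbin q t M u v * eval x (MM q t M u) =
        (a / c) ^ wt v * (qfac q t b v / qfac q t (a * b / c) v) *
          (∏ i : Fin n, qpochInf (a * t ^ (n - 1 - (i : ℕ))) q * qpochInf (c * x i) q /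
            (qpochInf (c * t ^ (n - 1 - (i : ℕ))) q * qpochInf (a * x i) q)) *
          ∑' u : Fin n → ℕ,
            c ^ wt u * (qfac q t (a * b / c) u / qfac q t (a * t ^ (n - 1)) u) *
              qbin q t M u v * eval x (MM q t M u) := by
  have hg : Generic q t := ⟨hq0, hq1, ht, hqt⟩
  have hA := isNormalized_MM hg hM
  have hbin (u) : qbin q t M u v = eval (spec q t u) (MM q t M v) / mval q t v := by
    rw [qbin, hA.diag]
  simp only [hbin]
  generalize MM q t M = A at hA
  obtain ⟨T, hT1, hT⟩ := exists_norm_pow_le t n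
  set R := T + ∑ i, ‖x i‖ + 1 with hR
  have hS : 0 ≤ ∑ i, ‖x i‖ := Finset.sum_nonneg fun _ _ => norm_nonneg _
  have hTR : T < R := by linarith
  have hR1 : 1 ≤ R := by linarith
  have hx (i) : ‖x i‖ < R := by
    have := Finset.single_le_sum (fun i _ => norm_nonneg (x i)) (Finset.mem_univ i)
    linarith
  obtain ⟨K, hK, hAK⟩ : ∃ K : ℝ, 1 ≤ K ∧
      ∀ u x, (∀ i, ‖x i‖ ≤ R) → ‖eval x (A u)‖ ≤ K ^ wt u := by
    obtain ⟨m, rfl⟩ := Nat.exists_eq_add_of_lt hn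
    rw [Nat.zero_add] at *
    exact hA.exists_norm_eval_le hg (by linarith)
  have hp := pow_ne_zero (n - 1) ht
  obtain ⟨β, rfl⟩ : ∃ β, b = β * t ^ (n - 1) := ⟨b / t ^ (n - 1), by field_simp⟩
  set Z := 1 + ‖β‖ * T with hZ
  have hZ1 : 1 ≤ Z := by
    have : 0 ≤ ‖β‖ * T := by positivity
    linarith
  obtain ⟨ε, hε0, hεR, hεZ⟩ : ∃ ε > 0, ε * R ≤ 1 / 4 ∧ ε * Z * K ≤ 1 / 4 := by
    refine ⟨(4 * K * R * Z)⁻¹, by positivity, ?_, ?_⟩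
    · rw [inv_mul_eq_div, div_le_iff₀ (by positivity)]
      have := mul_le_mul_of_nonneg_right (one_le_mul_of_one_le_of_one_le hK hZ1)
        (by linarith : 0 ≤ R)
      linarith
    · rw [mul_assoc, inv_mul_eq_div, div_le_iff₀ (by positivity)]
      have := mul_le_mul_of_nonneg_right hR1 (by positivity : 0 ≤ Z * K)
      linarith
  refine ⟨ε, hε0, fun a c _ ha hc0 hc hv => ?_⟩
  have hsR {s : ℂ} (hs : ‖s‖ < ε) : ‖s‖ * R ≤ 1 / 4 :=
    (mul_le_mul_of_nonneg_right hs.le (by linarith)).trans hεR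
  have hsZ {s : ℂ} (hs : ‖s‖ < ε) : (‖s‖ + ‖a * β‖ * T) * K ≤ 1 / 4 := by
    refine le_trans (mul_le_mul_of_nonneg_right ?_ (by linarith)) hεZ
    rw [norm_mul, mul_assoc, hZ, mul_add, mul_one]
    gcongr
  have hc0' : c ≠ 0 := norm_pos_iff.1 hc0
  set g := a * β / c with hgd
  have hgq : a * (β * t ^ (n - 1)) / c = g * t ^ (n - 1) := by rw [hgd]; ring
  simp only [hgq, qfac_mul_pow ht] at hv ⊢
  have hag : a * β = c * g := by rw [hgd]; field_simp
  have hcg : (‖c‖ + ‖c * g‖ * T) * K ≤ 1 / 4 := hag ▸ hsZ hc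
  have hsT {s : ℂ} (hs : ‖s‖ < ε) : ‖s‖ * T ≤ 1 / 2 := by
    have := mul_le_mul_of_nonneg_left hTR.le (norm_nonneg s)
    linarith [hsR hs]
  have hx' i := (hx i).le
  have hid := hA.heine hg hT hTR hK hAK v hc0' (hsT ha) (hsT hc) (hsZ ha) hcg hag hx
  refine ⟨fun u => ⟨cfac_ne_zero hq1 hT (hsT hc) u, cfac_ne_zero hq1 hT (hsT ha) u⟩,
    summable_norm_heineTerm hq1 hT hTR.le hK hAK v (hsT hc) (hsZ ha) hx',
    summable_norm_heineTerm hq1 hT hTR.le hK hAK v (hsT ha) hcg hx', ?_⟩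
  have hP {s : ℂ} {y : Fin n → ℂ} (hs : ‖s‖ < ε) (hy : ∀ i, ‖y i‖ < R) :
      ∏ i, qpochInf (s * y i) q ≠ 0 := by
    refine Finset.prod_ne_zero_iff.2 fun i _ => qpochInf_ne_zero hq1 ?_
    rw [norm_mul]
    have := mul_le_mul_of_nonneg_left (hy i).le (norm_nonneg s)
    linarith [hsR hs]
  have hP1 := hP (y := fun i : Fin n => t ^ (n - 1 - (i : ℕ))) hc
    fun i => (hT _ (by omega)).trans_lt hTR
  have hP2 := hP ha hx
  change ∑' u, heineTerm q t A v a β c u x = _ * _ * _ * ∑' u, heineTerm q t A v c g a u x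
  rw [Finset.prod_div_distrib, Finset.prod_mul_distrib, Finset.prod_mul_distrib]
  have hcv := pow_ne_zero (wt v) hc0'
  rw [div_pow]
  field_simp
  linear_combination hid

end LRW
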